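/- arXiv:1901.06425 — 6 statements merged into one kernel-verified Lean document; each statement's English description precedes it below -/
import Mathlib

section
/- Let p be a prime and let d_1, d_2 be integers with 2 ≤ d_1 ≤ d_2. Then β(Z_{p^{d_1 - 1}} × Z_{p^{d_2 + 1}}) < β(Z_{p^{d_1}} × Z_{p^{d_2}}). In other words, β is strictly decreasing on the class of abelian p-groups of rank 2 and fixed order p^n (n ≥ 4), ordered by the lexicographic order on the partitions (d_2, d_1) of n. -/
noncomputable def beta (G : Type*) [Group G] : ℝ :=
  (Nat.card (Subgroup G) : ℝ) / (Nat.card G : ℝ)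

section SubgroupsOfProducts

variable {A B : Type*} [CommGroup A] [CommGroup B]

/-- The subgroup of `A × B` attached to a homomorphism from a subgroup of `A` to a quotient
of `B`. -/
def subgroupOfQuotientHom (s : Σ K : Subgroup A, Σ L : Subgroup B, (K →* B ⧸ L)) :
    Subgroup (A × B) where
  carrier := {z | ∃ h : z.1 ∈ s.1, s.2.2 ⟨z.1, h⟩ = (z.2 : B ⧸ s.2.1)}
  one_mem' := ⟨s.1.one_mem, map_one s.2.2⟩
  mul_mem' := by
    rintro x y ⟨hx, hx'⟩ ⟨hy, hy'⟩
    refine ⟨s.1.mul_mem hx hy, ?_⟩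
    exact (map_mul s.2.2 ⟨x.1, hx⟩ ⟨y.1, hy⟩).trans (congrArg₂ _ hx' hy')
  inv_mem' := by
    rintro x ⟨hx, hx'⟩
    refine ⟨s.1.inv_mem hx, ?_⟩
    exact (map_inv s.2.2 ⟨x.1, hx⟩).trans (congrArg _ hx')

theorem mem_subgroupOfQuotientHom {K : Subgroup A} {L : Subgroup B} {f : K →* B ⧸ L}
    {z : A × B} :
    z ∈ subgroupOfQuotientHom ⟨K, L, f⟩ ↔ ∃ h : z.1 ∈ K, f ⟨z.1, h⟩ = (z.2 : B ⧸ L) :=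
  Iff.rfl

theorem subgroupOfQuotientHom_injective :
    Function.Injective (subgroupOfQuotientHom (A := A) (B := B)) := by
  rintro ⟨K, L, f⟩ ⟨K', L', f'⟩ h
  have hmem : ∀ z : A × B, (∃ h : z.1 ∈ K, f ⟨z.1, h⟩ = (z.2 : B ⧸ L)) ↔
      ∃ h : z.1 ∈ K', f' ⟨z.1, h⟩ = (z.2 : B ⧸ L') := fun z => by
    rw [← mem_subgroupOfQuotientHom, h, mem_subgroupOfQuotientHom]
  obtain rfl : K = K' := by
    ext x
    constructor
    · intro hx
      obtain ⟨y, hy⟩ := QuotientGroup.mk_surjective (f ⟨x, hx⟩)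
      exact ((hmem (x, y)).1 ⟨hx, hy.symm⟩).1
    · intro hx
      obtain ⟨y, hy⟩ := QuotientGroup.mk_surjective (f' ⟨x, hx⟩)
      exact ((hmem (x, y)).2 ⟨hx, hy.symm⟩).1
  obtain rfl : L = L' := by
    ext y
    have hone (M : Subgroup B) (g : K →* B ⧸ M) :
        (∃ h : (1 : A) ∈ K, g ⟨1, h⟩ = (y : B ⧸ M)) ↔ y ∈ M := by
      rw [exists_prop_of_true K.one_mem, ← QuotientGroup.eq_one_iff, eq_comm]
      exact Eq.congr_right (map_one g)
    rw [← hone L f, ← hone L' f']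
    exact hmem (1, y)
  obtain rfl : f = f' := by
    ext ⟨x, hx⟩
    obtain ⟨y, hy⟩ := QuotientGroup.mk_surjective (f ⟨x, hx⟩)
    obtain ⟨_, hy'⟩ := (hmem (x, y)).1 ⟨hx, hy.symm⟩
    exact hy.symm.trans hy'.symm
  rfl

theorem subgroupOfQuotientHom_surjective :
    Function.Surjective (subgroupOfQuotientHom (A := A) (B := B)) := by
  intro H
  let K : Subgroup A := H.map (MonoidHom.fst A B)
  let L : Subgroup B := H.comap (MonoidHom.inr A B)
  have hK : ∀ x : K, ∃ y : B, ((x : A), y) ∈ H := by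
    rintro ⟨_, ⟨x, y⟩, hz, rfl⟩
    exact ⟨y, hz⟩
  have hL : ∀ {x : A} {y y' : B}, (x, y) ∈ H → ((y : B ⧸ L) = (y' : B ⧸ L) ↔ (x, y') ∈ H) := by
    intro x y y' h
    rw [QuotientGroup.eq, Subgroup.mem_comap, ← H.mul_mem_cancel_left h]
    simp
  choose g hg using hK
  let f : K →* B ⧸ L := MonoidHom.mk' (fun x => (g x : B ⧸ L)) fun x y => by
    rw [← QuotientGroup.mk_mul, hL (hg (x * y))]
    exact H.mul_mem (hg x) (hg y)
  refine ⟨⟨K, L, f⟩, ?_⟩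
  ext ⟨x, y⟩
  rw [mem_subgroupOfQuotientHom]
  constructor
  · rintro ⟨hx, hxy⟩
    exact (hL (hg ⟨x, hx⟩)).1 hxy
  · intro h
    have hx : x ∈ K := ⟨(x, y), h, rfl⟩
    exact ⟨hx, (hL (hg ⟨x, hx⟩)).2 h⟩

end SubgroupsOfProducts

section Cyclic

/-- There are `gcd (|H|, |G|)` homomorphisms between finite cyclic groups `G` and `H`. -/
theorem IsCyclic.card_monoidHom {G H : Type*} [CommGroup G] [CommGroup H] [IsCyclic G]
    [IsCyclic H] [Finite H] :
    Nat.card (G →* H) = (Nat.card H).gcd (Nat.card G) := by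
  obtain ⟨g, hg⟩ := IsCyclic.exists_generator (α := G)
  have hord := orderOf_eq_card_of_forall_mem_zpowers hg
  rw [← IsCyclic.card_powMonoidHom_ker]
  refine Nat.card_congr (Equiv.ofBijective
    (fun f => ⟨f g, by rw [MonoidHom.mem_ker, powMonoidHom_apply, ← map_pow, ← hord,
      pow_orderOf_eq_one, map_one]⟩) ⟨?_, ?_⟩)
  · intro f f' h
    exact (MonoidHom.eq_iff_eq_on_generator hg f f').2 (congrArg Subtype.val h)
  · rintro ⟨y, hy⟩
    have hy' : orderOf y ∣ orderOf g := by
      rw [hord]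
      exact orderOf_dvd_of_pow_eq_one hy
    exact ⟨monoidHomOfForallMemZpowers hg hy',
      Subtype.ext (monoidHomOfForallMemZpowers_apply_gen hg hy')⟩

theorem IsCyclic.subgroup_eq_ker_pow {G : Type*} [CommGroup G] [IsCyclic G] [Finite G]
    (K : Subgroup G) : K = (powMonoidHom (Nat.card K) : G →* G).ker := by
  refine Subgroup.eq_of_le_of_card_ge (fun x hx => ?_) ?_
  · exact congrArg Subtype.val (pow_card_eq_one' (x := (⟨x, hx⟩ : K)))
  · rw [IsCyclic.card_powMonoidHom_ker, Nat.gcd_eq_right K.card_subgroup_dvd_card]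

theorem IsCyclic.sum_subgroup_card {G : Type*} [CommGroup G] [IsCyclic G] [Finite G]
    [Fintype (Subgroup G)] (f : ℕ → ℕ) :
    ∑ K : Subgroup G, f (Nat.card K) = ∑ d ∈ (Nat.card G).divisors, f d := by
  refine Finset.sum_bij (fun K _ => Nat.card K) (fun K _ => ?_) (fun K _ K' _ h => ?_)
    (fun d hd => ?_) (fun _ _ => rfl)
  · exact Nat.mem_divisors.2 ⟨K.card_subgroup_dvd_card, Nat.card_pos.ne'⟩
  · rw [IsCyclic.subgroup_eq_ker_pow K, IsCyclic.subgroup_eq_ker_pow K', h]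
  · exact ⟨(powMonoidHom d : G →* G).ker, Finset.mem_univ _, by
      rw [IsCyclic.card_powMonoidHom_ker, Nat.gcd_eq_right (Nat.dvd_of_mem_divisors hd)]⟩

theorem IsCyclic.sum_subgroup_index {G : Type*} [CommGroup G] [IsCyclic G] [Finite G]
    [Fintype (Subgroup G)] (f : ℕ → ℕ) :
    ∑ K : Subgroup G, f K.index = ∑ d ∈ (Nat.card G).divisors, f d := by
  rw [← Nat.sum_div_divisors, ← IsCyclic.sum_subgroup_card fun d => f (Nat.card G / d)]
  refine Finset.sum_congr rfl fun K _ => ?_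
  rw [← K.index_mul_card, Nat.mul_div_cancel _ Nat.card_pos]

/-- The number of subgroups of a product of two finite cyclic groups. -/
theorem IsCyclic.card_subgroup_prod {A B : Type*} [CommGroup A] [CommGroup B] [IsCyclic A]
    [IsCyclic B] [Finite A] [Finite B] :
    Nat.card (Subgroup (A × B)) =
      ∑ d ∈ (Nat.card A).divisors, ∑ e ∈ (Nat.card B).divisors, e.gcd d := by
  have := Fintype.ofFinite (Subgroup A)
  have := Fintype.ofFinite (Subgroup B)
  have (K : Subgroup A) (L : Subgroup B) : Finite (K →* B ⧸ L) := DFunLike.finite _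
  rw [← Nat.card_congr (Equiv.ofBijective _
    ⟨subgroupOfQuotientHom_injective (A := A) (B := B), subgroupOfQuotientHom_surjective⟩),
    Nat.card_sigma, ← IsCyclic.sum_subgroup_card]
  refine Finset.sum_congr rfl fun K _ => ?_
  rw [Nat.card_sigma, ← IsCyclic.sum_subgroup_index]
  refine Finset.sum_congr rfl fun L _ => ?_
  have : IsCyclic (B ⧸ L) := isCyclic_of_surjective _ (QuotientGroup.mk'_surjective L)
  rw [IsCyclic.card_monoidHom, Subgroup.index_eq_card]

end Cyclic

theorem Nat.gcd_pow_pow_self (p i j : ℕ) : (p ^ i).gcd (p ^ j) = p ^ min i j := by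
  rcases le_total i j with h | h
  · rw [min_eq_left h, Nat.gcd_eq_left (pow_dvd_pow p h)]
  · rw [min_eq_right h, Nat.gcd_eq_right (pow_dvd_pow p h)]

theorem card_subgroup_zmod_prime_pow_prod {p : ℕ} (hp : p.Prime) (a b : ℕ) :
    Nat.card (Subgroup (Multiplicative (ZMod (p ^ a)) × Multiplicative (ZMod (p ^ b)))) =
      ∑ i ∈ Finset.range (a + 1), ∑ j ∈ Finset.range (b + 1), p ^ min j i := by
  have : NeZero p := ⟨hp.ne_zero⟩
  have (k : ℕ) : Nat.card (Multiplicative (ZMod (p ^ k))) = p ^ k := Nat.card_zmod _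
  rw [IsCyclic.card_subgroup_prod, this, this, Nat.sum_divisors_prime_pow hp]
  refine Finset.sum_congr rfl fun i _ => ?_
  rw [Nat.sum_divisors_prime_pow hp]
  exact Finset.sum_congr rfl fun j _ => Nat.gcd_pow_pow_self p j i

theorem sum_sum_pow_min_lt {p a b : ℕ} (hp : 0 < p) (hab : a + 1 ≤ b) :
    ∑ i ∈ Finset.range (a + 1), ∑ j ∈ Finset.range (b + 2), p ^ min j i <
      ∑ i ∈ Finset.range (a + 2), ∑ j ∈ Finset.range (b + 1), p ^ min j i := by
  simp_rw [Finset.sum_range_succ _ (b + 1)]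
  rw [Finset.sum_add_distrib, Finset.sum_range_succ _ (a + 1)]
  gcongr
  calc ∑ i ∈ Finset.range (a + 1), p ^ min (b + 1) i
      = ∑ i ∈ Finset.range (a + 1), p ^ min i (a + 1) :=
        Finset.sum_congr rfl fun i hi => by
          have := Finset.mem_range.1 hi
          congr 1
          omega
    _ < ∑ i ∈ Finset.range (a + 2), p ^ min i (a + 1) := by
        rw [Finset.sum_range_succ _ (a + 1)]
        exact Nat.lt_add_of_pos_right (pow_pos hp _)
    _ ≤ ∑ j ∈ Finset.range (b + 1), p ^ min j (a + 1) :=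
        Finset.sum_le_sum_of_subset (Finset.range_mono (by omega))

theorem stmt_8 (p d1 d2 : ℕ) (hp : p.Prime) (h1 : 2 ≤ d1) (h12 : d1 ≤ d2) :
    beta (Multiplicative (ZMod (p ^ (d1 - 1))) × Multiplicative (ZMod (p ^ (d2 + 1))))
      < beta (Multiplicative (ZMod (p ^ d1)) × Multiplicative (ZMod (p ^ d2))) := by
  obtain ⟨a, rfl⟩ : ∃ a, d1 = a + 1 := ⟨d1 - 1, by omega⟩
  have hcard (k : ℕ) : Nat.card (Multiplicative (ZMod (p ^ k))) = p ^ k := Nat.card_zmod _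
  have hpos : (0 : ℝ) < ((p ^ (a + 1) * p ^ d2 : ℕ) : ℝ) := by
    exact_mod_cast Nat.mul_pos (pow_pos hp.pos _) (pow_pos hp.pos _)
  have horder : p ^ a * p ^ (d2 + 1) = p ^ (a + 1) * p ^ d2 := by ring
  rw [Nat.add_sub_cancel, beta, beta, Nat.card_prod, Nat.card_prod, hcard, hcard, hcard, hcard,
    horder, card_subgroup_zmod_prime_pow_prod hp, card_subgroup_zmod_prime_pow_prod hp]
  exact div_lt_div_of_pos_right (by exact_mod_cast sum_sum_pow_min_lt hp.pos h12) hpos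
end

section
/- Let p be an odd prime, n ≥ 4 an integer, and G an abelian group of order p^n such that G is not isomorphic to Z_{p^n} and not isomorphic to Z_p × Z_{p^{n-1}}. Then β(G) ≥ β(Z_{p^2} × Z_{p^{n-2}}) = ((n-3)p^2 + (n-1)(p+1) + 2)/p^n. -/
/-- The number of subgroups of `G` is at least the number of subgroups of `M` plus the size of any
family of subgroups not contained in `M`. -/
theorem card_subgroup_add_ncard_le {G : Type*} [Group G] [Finite G] (M : Subgroup G)
    (T : Set (Subgroup G)) (hT : ∀ K ∈ T, ¬ K ≤ M) :
    Nat.card (Subgroup M) + T.ncard ≤ Nat.card (Subgroup G) := by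
  have hinj : Function.Injective (Subgroup.map M.subtype) :=
    Subgroup.map_injective M.subtype_injective
  have hdisj : Disjoint (Set.range (Subgroup.map M.subtype)) T := by
    rw [Set.disjoint_left]
    rintro _ ⟨K, rfl⟩ hK
    exact hT _ hK (Subgroup.map_subtype_le K)
  have hr : (Set.range (Subgroup.map M.subtype)).ncard = Nat.card (Subgroup M) := by
    rw [← Set.image_univ, Set.ncard_image_of_injective _ hinj, Set.ncard_univ]
  rw [← hr, ← Set.ncard_union_eq hdisj (Set.toFinite _) (Set.toFinite _), ← Set.ncard_univ]
  exact Set.ncard_le_ncard (Set.subset_univ _) (Set.toFinite _)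

/-- If `M` has index `p` and every `D ⊔ ⟨x⟩` with `x ∉ M` has at most `p ^ k` elements, then there
are at least `p ^ (n - k)` subgroups of this form. -/
theorem pow_le_ncard_sup_zpowers {p n k : ℕ} (hp : p.Prime) (hkn : k ≤ n) {G : Type*} [CommGroup G]
    [Finite G] (hG : Nat.card G = p ^ n) (M D : Subgroup G) (hM : M.index = p)
    (hD : ∀ x ∉ M, Nat.card (D ⊔ Subgroup.zpowers x : Subgroup G) ≤ p ^ k) :
    p ^ (n - k) ≤ (Set.image (fun x => D ⊔ Subgroup.zpowers x) {x | x ∉ M}).ncard := by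
  classical
  have := Fintype.ofFinite G
  have hp1 : 1 < p := hp.one_lt
  -- the number of elements of a subgroup outside `M`
  have key : ∀ K : Subgroup G,
      Nat.card K = Nat.card (M ⊓ K : Subgroup G) + {x | x ∈ K ∧ x ∉ M}.ncard := by
    intro K
    have h := Set.ncard_inter_add_ncard_sdiff_eq_ncard (K : Set G) (M : Set G) (Set.toFinite _)
    rw [← Nat.card_coe_set_eq, ← Nat.card_coe_set_eq (s := (K : Set G)), Set.inter_comm] at h
    exact h.symm
  have hfib : ∀ x ∉ M, p * {y | y ∈ D ⊔ Subgroup.zpowers x ∧ y ∉ M}.ncard ≤ (p - 1) * p ^ k := by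
    intro x hx
    set K := D ⊔ Subgroup.zpowers x
    have h1 := key K
    have h2 : Nat.card K ≤ p * Nat.card (M ⊓ K : Subgroup G) := by
      have h3 : M.relIndex K * Nat.card (M ⊓ K : Subgroup G) = Nat.card K := by
        rw [← Subgroup.inf_relIndex_right, Subgroup.relIndex, mul_comm,
          ← Subgroup.card_mul_index ((M ⊓ K).subgroupOf K)]
        congr 1
        exact (Nat.card_congr (Subgroup.subgroupOfEquivOfLe inf_le_right).toEquiv).symm
      have h4 : M.relIndex K ∣ p := hM ▸ Subgroup.relIndex_dvd_index_of_normal M K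
      rw [← h3]
      exact Nat.mul_le_mul_right _ (Nat.le_of_dvd hp.pos h4)
    have h5 := hD x hx
    obtain ⟨q, rfl⟩ : ∃ q, p = q + 1 := ⟨p - 1, by omega⟩
    simp only [Nat.add_sub_cancel]
    nlinarith
  have htot : p * {x | x ∉ M}.ncard = (p - 1) * p ^ n := by
    have h1 := key ⊤
    have h2 := M.index_mul_card
    rw [Subgroup.card_top, inf_top_eq] at h1
    simp only [Subgroup.mem_top, true_and] at h1
    rw [hG] at h1 h2
    rw [hM] at h2
    obtain ⟨q, rfl⟩ : ∃ q, p = q + 1 := ⟨p - 1, by omega⟩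
    simp only [Nat.add_sub_cancel]
    nlinarith
  have hk : 0 < (p - 1) * p ^ k := Nat.mul_pos (by omega) (pow_pos hp.pos k)
  set S := (Finset.univ.filter fun x : G => x ∉ M)
  have hS : {x | x ∉ M} = (S : Set G) := by ext; simp [S]
  rw [hS] at htot ⊢
  rw [← Finset.coe_image, Set.ncard_coe_finset]
  rw [Set.ncard_coe_finset] at htot
  have hle := Finset.card_le_mul_card_image (f := fun x => D ⊔ Subgroup.zpowers x) S
    ((p - 1) * p ^ k / p) (by
      intro K hK
      obtain ⟨x, hx, rfl⟩ := Finset.mem_image.1 hK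
      rw [Nat.le_div_iff_mul_le hp.pos, mul_comm]
      refine le_trans (Nat.mul_le_mul_left _ ?_) (hfib x (by simpa [S] using hx))
      rw [← Set.ncard_coe_finset]
      refine Set.ncard_le_ncard ?_ (Set.toFinite _)
      intro y hy
      simp only [Finset.coe_filter, S, Finset.mem_univ, true_and, Finset.mem_filter,
        Set.mem_ofPred_eq] at hy ⊢
      refine ⟨?_, hy.1⟩
      rw [← hy.2]
      exact (le_sup_right : Subgroup.zpowers y ≤ _) (Subgroup.mem_zpowers y))
  have h1 : (p - 1) * p ^ n ≤ (p - 1) * p ^ k * (S.image fun x => D ⊔ Subgroup.zpowers x).card := by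
    rw [← htot]
    calc p * S.card ≤ p * ((p - 1) * p ^ k / p * _) := Nat.mul_le_mul_left _ hle
      _ = (p * ((p - 1) * p ^ k / p)) * _ := by ring
      _ ≤ _ := Nat.mul_le_mul_right _ (Nat.mul_div_le _ _)
  rw [show p ^ n = p ^ k * p ^ (n - k) by rw [← pow_add]; congr 1; omega, ← mul_assoc] at h1
  exact Nat.le_of_mul_le_mul_left h1 hk

theorem card_le_pow_of_ne_top {p m : ℕ} (hp : p.Prime) {G : Type*} [Group G] [Finite G]
    (hG : Nat.card G = p ^ (m + 1)) {K : Subgroup G} (hK : K ≠ ⊤) : Nat.card K ≤ p ^ m := by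
  obtain ⟨j, hj, hKj⟩ := (Nat.dvd_prime_pow hp).1 (hG ▸ K.card_subgroup_dvd_card)
  rw [hKj]
  refine Nat.pow_le_pow_right hp.pos ?_
  by_contra h
  refine hK (Subgroup.eq_top_of_card_eq K ?_)
  rw [hKj, hG, show j = m + 1 by omega]

/-- A maximal subgroup of a noncyclic group misses at least `p` subgroups of index `p`. -/
theorem exists_family_card_eq_pow {p m : ℕ} (hp : p.Prime) (hm : 1 ≤ m) {G : Type*} [CommGroup G]
    [Finite G] (hG : Nat.card G = p ^ (m + 1)) (hexp : ∀ x : G, x ^ p ^ m = 1)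
    (M : Subgroup G) (hM : M.index = p) :
    ∃ T : Set (Subgroup G), p ≤ T.ncard ∧ ∀ K ∈ T, Nat.card K = p ^ m ∧ ¬ K ≤ M := by
  have : Fact p.Prime := ⟨hp⟩
  have hMtop : M ≠ ⊤ := by
    rintro rfl
    exact hp.one_lt.ne (by simpa using hM)
  obtain ⟨x, hx⟩ : ∃ x, x ∉ M := by
    by_contra! h
    exact hMtop ((Subgroup.eq_top_iff' M).2 h)
  obtain ⟨j, hj, hxj⟩ := (Nat.dvd_prime_pow hp).1 (orderOf_dvd_of_pow_eq_one (hexp x))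
  obtain ⟨N, hN, hxN⟩ := Sylow.exists_subgroup_card_pow_prime_le (m := m) p
    (hG ▸ pow_dvd_pow p (Nat.le_succ m)) (Subgroup.zpowers x) (by rw [Nat.card_zpowers, hxj]) hj
  replace hxN : x ∈ N := hxN (Subgroup.mem_zpowers x)
  have hNi : N.index = p := by
    have h := N.index_mul_card
    rw [hN, hG, pow_succ'] at h
    exact Nat.eq_of_mul_eq_mul_right (pow_pos hp.pos m) h
  obtain ⟨l, rfl⟩ : ∃ l, m = l + 1 := ⟨m - 1, by omega⟩
  set D := M ⊓ N
  have hpow : ∀ y : G, y ^ p ∈ D := fun y =>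
    ⟨hM ▸ M.pow_index_mem y, hNi ▸ N.pow_index_mem y⟩
  have hDlt : Nat.card D < p ^ (l + 1) := by
    rw [← hN]
    refine lt_of_le_of_ne (Subgroup.card_le_of_le inf_le_right) fun h => hx ?_
    have hND : N ≤ D := (Subgroup.eq_of_le_of_card_ge inf_le_right h.ge).ge
    exact (hND hxN).1
  have hDi : D.index ≤ p * p := by
    have h := Subgroup.index_inf_le (H := M) (K := N)
    rwa [hM, hNi] at h
  have hDc : Nat.card D = p ^ l := by
    obtain ⟨j, hj, hDj⟩ := (Nat.dvd_prime_pow hp).1 (hG ▸ D.card_subgroup_dvd_card)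
    have h := D.index_mul_card
    rw [hDj] at hDlt h
    have h1 := (Nat.pow_lt_pow_iff_right hp.one_lt).1 hDlt
    have h2 : p ^ (l + 1 + 1) ≤ p ^ (2 + j) := by
      rw [← hG, ← h, pow_add, sq]
      exact Nat.mul_le_mul_right _ hDi
    have h3 := (Nat.pow_le_pow_iff_right hp.one_lt).1 h2
    rw [hDj, show j = l by omega]
  have hDi' : D.index = p * p := by
    have h := D.index_mul_card
    rw [hDc, hG, show p ^ (l + 1 + 1) = p * p * p ^ l by ring] at h
    exact Nat.eq_of_mul_eq_mul_right (pow_pos hp.pos l) h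
  have hsup : ∀ y ∉ M, Nat.card (D ⊔ Subgroup.zpowers y : Subgroup G) = p ^ (l + 1) := by
    intro y hy
    refine le_antisymm (card_le_pow_of_ne_top hp hG fun htop => ?_) ?_
    · have hgen : ∀ q : G ⧸ D, q ∈ Subgroup.zpowers (y : G ⧸ D) := by
        intro q
        obtain ⟨g, rfl⟩ := QuotientGroup.mk_surjective q
        obtain ⟨d, hd, z, hz, rfl⟩ := Subgroup.mem_sup.1 (htop ▸ Subgroup.mem_top g)
        obtain ⟨k, rfl⟩ := Subgroup.mem_zpowers_iff.1 hz
        refine Subgroup.mem_zpowers_iff.2 ⟨k, ?_⟩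
        rw [QuotientGroup.mk_mul, (QuotientGroup.eq_one_iff d).2 hd, one_mul, QuotientGroup.mk_zpow]
      have h1 := orderOf_eq_card_of_forall_mem_zpowers hgen
      have h2 : orderOf (y : G ⧸ D) ≤ p := by
        refine orderOf_le_of_pow_eq_one hp.pos ?_
        rw [← QuotientGroup.mk_pow, QuotientGroup.eq_one_iff]
        exact hpow y
      rw [h1, ← Subgroup.index, hDi'] at h2
      nlinarith [hp.one_lt]
    · obtain ⟨j, hj, hKj⟩ :=
        (Nat.dvd_prime_pow hp).1 (hG ▸ (D ⊔ Subgroup.zpowers y).card_subgroup_dvd_card)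
      rw [hKj]
      refine Nat.pow_le_pow_right hp.pos ?_
      by_contra hlt
      have hle : D ⊔ Subgroup.zpowers y ≤ D := (Subgroup.eq_of_le_of_card_ge le_sup_left (by
        rw [hKj, hDc]
        exact Nat.pow_le_pow_right hp.pos (by omega))).ge
      exact hy (hle ((le_sup_right : Subgroup.zpowers y ≤ _) (Subgroup.mem_zpowers y))).1
  refine ⟨Set.image (fun y => D ⊔ Subgroup.zpowers y) {y | y ∉ M}, ?_, ?_⟩
  · have h := pow_le_ncard_sup_zpowers hp (k := l + 1) (by omega) hG M D hM
      fun y hy => (hsup y hy).le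
    simpa using h
  · rintro _ ⟨y, hy, rfl⟩
    exact ⟨hsup y hy, fun h => hy (h ((le_sup_right : Subgroup.zpowers y ≤ _)
      (Subgroup.mem_zpowers y)))⟩

theorem exists_index_eq_prime {p m : ℕ} (hp : p.Prime) {G : Type*} [Group G] [Finite G]
    (hG : Nat.card G = p ^ (m + 1)) : ∃ M : Subgroup G, M.index = p := by
  have : Fact p.Prime := ⟨hp⟩
  obtain ⟨M, hM⟩ := Sylow.exists_subgroup_card_pow_prime p (hG ▸ pow_dvd_pow p (Nat.le_succ m))
  refine ⟨M, ?_⟩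
  have h := M.index_mul_card
  rw [hM, hG, pow_succ'] at h
  exact Nat.eq_of_mul_eq_mul_right (pow_pos hp.pos m) h

theorem card_eq_of_index_eq_prime {p m : ℕ} (hp : p.Prime) {G : Type*} [Group G] [Finite G]
    (hG : Nat.card G = p ^ (m + 1)) {M : Subgroup G} (hM : M.index = p) : Nat.card M = p ^ m := by
  have h := M.index_mul_card
  rw [hM, hG, pow_succ'] at h
  exact Nat.eq_of_mul_eq_mul_left hp.pos h

/-- In a large enough abelian `p`-group, some subgroup of index `p` has exponent at most
`p ^ e` when the group has exponent at most `p ^ (e + 1)`. -/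
theorem exists_index_eq_prime_pow_eq_one {p e r : ℕ} (hp : p.Prime) (hre : r ≤ e) {G : Type*}
    [CommGroup G] [Finite G] (hG : Nat.card G = p ^ (e + 1 + r))
    (hexp : ∀ x : G, x ^ p ^ (e + 1) = 1) :
    ∃ M : Subgroup G, M.index = p ∧ ∀ x : M, x ^ p ^ e = 1 := by
  have : Fact p.Prime := ⟨hp⟩
  by_cases h : ∀ x : G, x ^ p ^ e = 1
  · obtain ⟨M, hM⟩ := exists_index_eq_prime hp (m := e + r) (by rw [hG]; congr 1; omega)
    exact ⟨M, hM, fun x => Subtype.ext (by simpa using h x)⟩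
  push Not at h
  obtain ⟨x, hx⟩ := h
  have hxo : orderOf x = p ^ (e + 1) := orderOf_eq_prime_pow hx (hexp x)
  set f : G →* G := powMonoidHom (p ^ e)
  refine ⟨f.ker, ?_, fun y => Subtype.ext (MonoidHom.mem_ker.1 y.2)⟩
  have hind : (Subgroup.zpowers x).index = p ^ r := by
    have h := (Subgroup.zpowers x).index_mul_card
    rw [Nat.card_zpowers, hxo, hG, pow_add p (e + 1) r, mul_comm (p ^ (e + 1))] at h
    exact Nat.eq_of_mul_eq_mul_right (pow_pos hp.pos _) h
  have hrange : f.range ≤ Subgroup.zpowers x := by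
    rintro _ ⟨y, rfl⟩
    obtain ⟨s, rfl⟩ := Nat.exists_eq_add_of_le hre
    have := (Subgroup.zpowers x).pow_mem (hind ▸ (Subgroup.zpowers x).pow_index_mem y) (p ^ s)
    simpa [f, ← pow_mul, ← pow_add] using this
  rw [Subgroup.index_ker]
  have hle : Nat.card f.range ≤ p := by
    have h1 : f.range ≤ (powMonoidHom p : Subgroup.zpowers x →* _).ker.map
        (Subgroup.zpowers x).subtype := by
      rintro y hy
      refine ⟨⟨y, hrange hy⟩, ?_, rfl⟩
      obtain ⟨z, rfl⟩ := hy
      refine Subtype.ext ?_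
      simpa [f, ← pow_mul, ← pow_succ] using hexp z
    refine (Subgroup.card_le_of_le h1).trans ?_
    rw [Subgroup.card_map_of_injective (Subgroup.subtype_injective _), IsCyclic.card_powMonoidHom_ker]
    exact Nat.gcd_le_right _ hp.pos
  have hne : Nat.card f.range ≠ 1 := by
    intro h
    have h1 := (Subgroup.card_eq_one).1 h
    have h2 : f x ∈ f.range := ⟨x, rfl⟩
    rw [h1, Subgroup.mem_bot] at h2
    exact hx (by simpa [f] using h2)
  obtain ⟨j, hj, hcj⟩ := (Nat.dvd_prime_pow hp).1 (hG ▸ f.range.card_subgroup_dvd_card)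
  have hj1 : j ≤ 1 := (Nat.pow_le_pow_iff_right hp.one_lt).1 (by rwa [pow_one, ← hcj])
  interval_cases j
  · simp_all
  · simpa using hcj

theorem card_subgroup_add_le_of_pow_eq_one {p m : ℕ} (hp : p.Prime) (hm : 1 ≤ m) {G : Type*}
    [CommGroup G] [Finite G] (hG : Nat.card G = p ^ (m + 1)) (hexp : ∀ x : G, x ^ p ^ m = 1)
    (M : Subgroup G) (hM : M.index = p) :
    Nat.card (Subgroup M) + (p + 1) ≤ Nat.card (Subgroup G) := by
  obtain ⟨T, hT, hTM⟩ := exists_family_card_eq_pow hp hm hG hexp M hM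
  have htop : ⊤ ∉ T := fun h => by
    have := (hTM _ h).1
    rw [Subgroup.card_top, hG] at this
    exact absurd (Nat.pow_right_injective hp.two_le this) (by omega)
  have h := card_subgroup_add_ncard_le M (insert ⊤ T) (by
    rintro K (rfl | hK) hle
    · rw [top_le_iff.1 hle, Subgroup.index_top] at hM
      exact hp.one_lt.ne hM
    · exact (hTM K hK).2 hle)
  rw [Set.ncard_insert_of_notMem htop (Set.toFinite _)] at h
  omega

theorem card_subgroup_add_sq_le_of_pow_eq_one {p m : ℕ} (hp : p.Prime) (hm : 1 ≤ m) {G : Type*}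
    [CommGroup G] [Finite G] (hG : Nat.card G = p ^ (m + 2)) (hexp : ∀ x : G, x ^ p ^ m = 1)
    (M : Subgroup G) (hM : M.index = p) :
    Nat.card (Subgroup M) + (p ^ 2 + p + 1) ≤ Nat.card (Subgroup G) := by
  obtain ⟨T, hT, hTM⟩ := exists_family_card_eq_pow hp (m := m + 1) (by omega) hG
    (fun x => by rw [pow_succ, pow_mul, hexp, one_pow]) M hM
  have hcyc : ∀ x : G, Nat.card (⊥ ⊔ Subgroup.zpowers x : Subgroup G) ≤ p ^ m := fun x => by
    rw [bot_sup_eq, Nat.card_zpowers]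
    exact orderOf_le_of_pow_eq_one (pow_pos hp.pos m) (hexp x)
  have hC := pow_le_ncard_sup_zpowers hp (k := m) (by omega) hG M ⊥ hM fun x _ => hcyc x
  rw [Nat.add_sub_cancel_left] at hC
  set C := Set.image (fun x => ⊥ ⊔ Subgroup.zpowers x) {x | x ∉ M}
  have hdisj : Disjoint T C := by
    rw [Set.disjoint_left]
    rintro _ hK ⟨x, -, rfl⟩
    have h1 := hcyc x
    rw [(hTM _ hK).1] at h1
    exact absurd ((Nat.pow_le_pow_iff_right hp.one_lt).1 h1) (by omega)
  have htop : ⊤ ∉ T ∪ C := by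
    rintro (h | ⟨x, -, h⟩)
    · have := (hTM _ h).1
      rw [Subgroup.card_top, hG] at this
      exact absurd (Nat.pow_right_injective hp.two_le this) (by omega)
    · have h1 := hcyc x
      simp only at h
      rw [h, Subgroup.card_top, hG] at h1
      exact absurd ((Nat.pow_le_pow_iff_right hp.one_lt).1 h1) (by omega)
  have h := card_subgroup_add_ncard_le M (insert ⊤ (T ∪ C)) (by
    rintro K (rfl | hK | ⟨x, hx, rfl⟩) hle
    · rw [top_le_iff.1 hle, Subgroup.index_top] at hM
      exact hp.one_lt.ne hM
    · exact (hTM K hK).2 hle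
    · exact hx (hle ((le_sup_right : Subgroup.zpowers x ≤ _) (Subgroup.mem_zpowers x))))
  rw [Set.ncard_insert_of_notMem htop (Set.toFinite _),
    Set.ncard_union_eq hdisj (Set.toFinite _) (Set.toFinite _)] at h
  omega

/-- A noncyclic abelian group of order `p ^ (m + 2)` has at least `(m + 1) * (p + 1) + 2`
subgroups. -/
theorem le_card_subgroup_of_pow_eq_one {p : ℕ} (hp : p.Prime) (m : ℕ) {G : Type*}
    [CommGroup G] [Finite G] (hG : Nat.card G = p ^ (m + 2)) (hexp : ∀ x : G, x ^ p ^ (m + 1) = 1) :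
    (m + 1) * (p + 1) + 2 ≤ Nat.card (Subgroup G) := by
  induction m generalizing G with
  | zero =>
    obtain ⟨M, hM⟩ := exists_index_eq_prime hp hG
    have hMc := card_eq_of_index_eq_prime hp hG hM
    have : Nontrivial M := Finite.one_lt_card_iff_nontrivial.1 (by simpa [hMc] using hp.one_lt)
    have h1 : 1 < Nat.card (Subgroup M) := Finite.one_lt_card
    have h2 := card_subgroup_add_le_of_pow_eq_one hp (by omega) hG hexp M hM
    omega
  | succ m ih =>
    obtain ⟨M, hM, hMe⟩ := exists_index_eq_prime_pow_eq_one hp (e := m + 1) (r := 1) (by omega)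
      (by rw [hG]) hexp
    have h1 := ih (card_eq_of_index_eq_prime hp hG hM) hMe
    have h2 := card_subgroup_add_le_of_pow_eq_one hp (by omega) hG hexp M hM
    linarith

/-- An abelian group of order `p ^ (m + 4)` and exponent at most `p ^ (m + 2)` has at least as many
subgroups as `Z_{p ^ 2} × Z_{p ^ (m + 2)}`. -/
theorem le_card_subgroup_of_pow_eq_one_of_four_le {p : ℕ} (hp : p.Prime) (m : ℕ) {G : Type*}
    [CommGroup G] [Finite G] (hG : Nat.card G = p ^ (m + 4)) (hexp : ∀ x : G, x ^ p ^ (m + 2) = 1) :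
    (m + 1) * p ^ 2 + (m + 3) * (p + 1) + 2 ≤ Nat.card (Subgroup G) := by
  induction m generalizing G with
  | zero =>
    obtain ⟨M, hM⟩ := exists_index_eq_prime hp hG
    have h1 := le_card_subgroup_of_pow_eq_one hp 1 (card_eq_of_index_eq_prime hp hG hM)
      (fun x => Subtype.ext (by simpa using hexp x))
    have h2 := card_subgroup_add_sq_le_of_pow_eq_one hp (by omega) hG hexp M hM
    linarith
  | succ m ih =>
    obtain ⟨M, hM, hMe⟩ := exists_index_eq_prime_pow_eq_one hp (e := m + 2) (r := 2) (by omega)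
      (by rw [hG]) hexp
    have h1 := ih (card_eq_of_index_eq_prime hp hG hM) hMe
    have h2 := card_subgroup_add_sq_le_of_pow_eq_one hp (by omega) hG hexp M hM
    linarith

theorem IsCyclic.subgroup_eq_powMonoidHom_ker {A : Type*} [CommGroup A] [Finite A] [IsCyclic A]
    (K : Subgroup A) : K = (powMonoidHom (Nat.card K) : A →* A).ker := by
  refine Subgroup.eq_of_le_of_card_ge (fun x hx => ?_) ?_
  · have h : (⟨x, hx⟩ : K) ^ Nat.card K = 1 := pow_card_eq_one'
    exact congrArg Subtype.val h
  · rw [IsCyclic.card_powMonoidHom_ker]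
    exact Nat.gcd_le_right _ Nat.card_pos

theorem IsCyclic.injective_card_subgroup (A : Type*) [CommGroup A] [Finite A] [IsCyclic A] :
    Function.Injective fun K : Subgroup A => Nat.card K := by
  intro K L h
  simp only at h
  rw [IsCyclic.subgroup_eq_powMonoidHom_ker K, IsCyclic.subgroup_eq_powMonoidHom_ker L, h]

theorem IsCyclic.injective_index_subgroup (A : Type*) [CommGroup A] [Finite A] [IsCyclic A] :
    Function.Injective fun K : Subgroup A => K.index := by
  intro K L h
  refine IsCyclic.injective_card_subgroup A ?_
  simp only at h ⊢
  have h1 := K.index_mul_card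
  rw [← L.index_mul_card, h] at h1
  exact Nat.eq_of_mul_eq_mul_left (Nat.pos_of_ne_zero L.index_ne_zero_of_finite) h1

/-- The subgroups of `A × B` with given image in `A` and given intersection with `B`. -/
def subgroupProdFiber {A B : Type*} [CommGroup A] [CommGroup B] (A₁ : Subgroup A)
    (B₁ : Subgroup B) : Set (Subgroup (A × B)) :=
  {H | H.map (MonoidHom.fst A B) = A₁ ∧ H.comap (MonoidHom.inr A B) = B₁}

theorem ncard_subgroupProdFiber_le {A B : Type*} [CommGroup A] [CommGroup B] [Finite A] [Finite B]
    [IsCyclic A] [IsCyclic B] (A₁ : Subgroup A) (B₁ : Subgroup B) :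
    (subgroupProdFiber A₁ B₁).ncard ≤ B₁.index.gcd (Nat.card A₁) := by
  obtain ⟨⟨g, hg⟩, hgen⟩ := IsCyclic.exists_generator (α := A₁)
  have hlift : ∀ H ∈ subgroupProdFiber A₁ B₁, ∃ y : B, (g, y) ∈ H := by
    rintro H ⟨hA, -⟩
    rw [← hA] at hg
    obtain ⟨⟨a, y⟩, hy, rfl⟩ := hg
    exact ⟨y, hy⟩
  choose! y hy using hlift
  have hmem : ∀ H ∈ subgroupProdFiber A₁ B₁, ∀ b : B, (1, b) ∈ H ↔ b ∈ B₁ := by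
    rintro H ⟨-, hB⟩ b
    rw [← hB]
    rfl
  have hle : ∀ H ∈ subgroupProdFiber A₁ B₁, ∀ H' ∈ subgroupProdFiber A₁ B₁,
      (y H : B ⧸ B₁) = y H' → H ≤ H' := by
    rintro H hH H' hH' hyy ⟨a, b⟩ hab
    have ha : a ∈ A₁ := by
      rw [← hH.1]
      exact ⟨_, hab, rfl⟩
    obtain ⟨k, hk⟩ := Subgroup.mem_zpowers_iff.1 (hgen ⟨a, ha⟩)
    replace hk : g ^ k = a := congrArg Subtype.val hk
    have h1 : (y H)⁻¹ * y H' ∈ B₁ := QuotientGroup.eq.1 hyy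
    have h2 : (y H ^ k)⁻¹ * b ∈ B₁ := by
      rw [← hmem H hH]
      have := H.mul_mem (H.inv_mem (H.zpow_mem (hy H hH) k)) hab
      simpa [hk] using this
    have h3 : (y H' ^ k)⁻¹ * b ∈ B₁ := by
      have := B₁.mul_mem (B₁.inv_mem (B₁.zpow_mem h1 k)) h2
      convert this using 1
      rw [mul_zpow, inv_zpow]
      group
    rw [← hmem H' hH'] at h3
    have := H'.mul_mem (H'.zpow_mem (hy H' hH') k) h3
    simpa [hk] using this
  have hcard : Nat.card (powMonoidHom (Nat.card A₁) : B ⧸ B₁ →* B ⧸ B₁).ker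
      = B₁.index.gcd (Nat.card A₁) := by
    rw [IsCyclic.card_powMonoidHom_ker]
    rfl
  rw [← hcard]
  refine Set.ncard_le_ncard_of_injOn (fun H => (y H : B ⧸ B₁)) ?_ ?_ (Set.toFinite _)
  · intro H hH
    change (y H : B ⧸ B₁) ^ Nat.card A₁ = 1
    rw [← QuotientGroup.mk_pow, QuotientGroup.eq_one_iff, ← hmem H hH]
    have h1 := H.pow_mem (hy H hH) (Nat.card A₁)
    have h2 : (⟨g, hg⟩ : A₁) ^ Nat.card A₁ = 1 := pow_card_eq_one'
    replace h2 : g ^ Nat.card A₁ = 1 := congrArg Subtype.val h2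
    rwa [Prod.pow_mk, h2] at h1
  · intro H hH H' hH' h
    exact le_antisymm (hle H hH H' hH' h) (hle H' hH' H hH h.symm)

theorem card_subgroup_prod_le {A B : Type*} [CommGroup A] [CommGroup B] [Finite A] [Finite B]
    [IsCyclic A] [IsCyclic B] :
    Nat.card (Subgroup (A × B)) ≤
      ∑ u ∈ (Nat.card A).divisors, ∑ v ∈ (Nat.card B).divisors, v.gcd u := by
  classical
  have := Fintype.ofFinite (Subgroup A)
  have := Fintype.ofFinite (Subgroup B)
  have := Fintype.ofFinite (Subgroup (A × B))
  calc Nat.card (Subgroup (A × B))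
      ≤ ∑ P : Subgroup A × Subgroup B, (subgroupProdFiber P.1 P.2).ncard := by
        rw [Nat.card_eq_fintype_card, ← Finset.card_univ, Finset.card_eq_sum_card_fiberwise
          (f := fun H => (H.map (MonoidHom.fst A B), H.comap (MonoidHom.inr A B)))
          (t := Finset.univ) (fun _ _ => Finset.mem_coe.2 (Finset.mem_univ _))]
        refine Finset.sum_le_sum fun P _ => ?_
        rw [← Set.ncard_coe_finset]
        refine Set.ncard_le_ncard (fun H hH => ?_) (Set.toFinite _)
        simp only [Finset.coe_filter, Finset.mem_univ, true_and, Set.mem_ofPred_eq] at hH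
        exact ⟨congrArg Prod.fst hH, congrArg Prod.snd hH⟩
    _ ≤ ∑ P : Subgroup A × Subgroup B, P.2.index.gcd (Nat.card P.1) :=
        Finset.sum_le_sum fun P _ => ncard_subgroupProdFiber_le P.1 P.2
    _ = ∑ A₁ : Subgroup A, ∑ B₁ : Subgroup B, B₁.index.gcd (Nat.card A₁) :=
        Fintype.sum_prod_type _
    _ ≤ ∑ A₁ : Subgroup A, ∑ v ∈ (Nat.card B).divisors, v.gcd (Nat.card A₁) := by
        refine Finset.sum_le_sum fun A₁ _ => ?_
        rw [← Finset.sum_image (f := fun v => v.gcd (Nat.card A₁))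
          (IsCyclic.injective_index_subgroup B).injOn]
        refine Finset.sum_le_sum_of_subset fun v hv => ?_
        obtain ⟨K, -, rfl⟩ := Finset.mem_image.1 hv
        exact Nat.mem_divisors.2 ⟨K.index_dvd_card, Nat.card_pos.ne'⟩
    _ ≤ _ := by
        rw [← Finset.sum_image (f := fun u => ∑ v ∈ (Nat.card B).divisors, v.gcd u)
          (IsCyclic.injective_card_subgroup A).injOn]
        refine Finset.sum_le_sum_of_subset fun v hv => ?_
        obtain ⟨K, -, rfl⟩ := Finset.mem_image.1 hv
        exact Nat.mem_divisors.2 ⟨K.card_subgroup_dvd_card, Nat.card_pos.ne'⟩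

theorem card_subgroup_prod_le_of_card_eq {p m : ℕ} (hp : p.Prime) {A B : Type*} [CommGroup A]
    [CommGroup B] [Finite A] [Finite B] [IsCyclic A] [IsCyclic B] (hA : Nat.card A = p ^ 2)
    (hB : Nat.card B = p ^ (m + 2)) :
    Nat.card (Subgroup (A × B)) ≤ (m + 1) * p ^ 2 + (m + 3) * (p + 1) + 2 := by
  refine card_subgroup_prod_le.trans (le_of_eq ?_)
  have hgcd : ∀ e, (p ^ (e + 1 + 1)).gcd (p ^ 2) = p ^ 2 := fun e =>
    Nat.gcd_eq_right (pow_dvd_pow p (by omega))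
  have hgcd' : ∀ e, (p ^ (e + 1)).gcd p = p := fun e =>
    Nat.gcd_eq_right (dvd_pow_self p (by omega))
  have hgcd₂ : p.gcd (p ^ 2) = p := Nat.gcd_eq_left (dvd_pow_self p (by omega))
  rw [hA, hB, Nat.sum_divisors_prime_pow hp, Finset.sum_range_succ, Finset.sum_range_succ,
    Finset.sum_range_one]
  simp only [Nat.sum_divisors_prime_pow hp]
  rw [Finset.sum_range_succ' (fun e => (p ^ e).gcd (p ^ 2)),
    Finset.sum_range_succ' (fun e => (p ^ (e + 1)).gcd (p ^ 2)),
    Finset.sum_range_succ' (fun e => (p ^ e).gcd (p ^ 1))]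
  simp only [hgcd, hgcd', hgcd₂, pow_zero, pow_one, zero_add, Nat.gcd_one_right, Nat.gcd_one_left,
    Finset.sum_const, Finset.card_range, smul_eq_mul]
  ring

theorem card_multiplicative_zmod (k : ℕ) : Nat.card (Multiplicative (ZMod k)) = k :=
  (Nat.card_congr Multiplicative.toAdd).trans (Nat.card_zmod k)

/-- An abelian group of order `p ^ (k + 2)` with an element of order `p ^ (k + 1)` is cyclic or
isomorphic to `Z_p × Z_{p ^ (k + 1)}`. -/
theorem isCyclic_or_nonempty_mulEquiv_prod {p k : ℕ} (hp : p.Prime) {G : Type*} [CommGroup G]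
    [Finite G] (hG : Nat.card G = p ^ (k + 2)) {x : G} (hx : orderOf x = p ^ (k + 1)) :
    IsCyclic G ∨
      Nonempty (G ≃* Multiplicative (ZMod p) × Multiplicative (ZMod (p ^ (k + 1)))) := by
  have : Fact p.Prime := ⟨hp⟩
  rw [or_iff_not_imp_left]
  intro hcyc
  have hexp : ∀ y : G, y ^ p ^ (k + 1) = 1 := by
    intro y
    obtain ⟨j, hj, hyj⟩ := (Nat.dvd_prime_pow hp).1 (hG ▸ orderOf_dvd_natCard y)
    rw [← orderOf_dvd_iff_pow_eq_one, hyj]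
    refine pow_dvd_pow p ?_
    by_contra h
    exact hcyc (isCyclic_of_orderOf_eq_card y (by rw [hyj, hG, show j = k + 2 by omega]))
  have hxc : Nat.card (Subgroup.zpowers x) = p ^ (k + 1) := by rw [Nat.card_zpowers, hx]
  have hind : (Subgroup.zpowers x).index = p := by
    have h := (Subgroup.zpowers x).index_mul_card
    rw [hxc, hG, pow_succ' p (k + 1)] at h
    exact Nat.eq_of_mul_eq_mul_right (pow_pos hp.pos _) h
  obtain ⟨y, hy⟩ : ∃ y, y ∉ Subgroup.zpowers x := by
    by_contra! h
    exact hcyc ⟨x, h⟩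
  obtain ⟨z, hzx, hzp⟩ : ∃ z, z ∉ Subgroup.zpowers x ∧ z ^ p = 1 := by
    have h1 : y ^ p ∈ Subgroup.zpowers x := hind ▸ (Subgroup.zpowers x).pow_index_mem y
    obtain ⟨a, ha⟩ := Subgroup.mem_zpowers_iff.1 h1
    have h2 : x ^ (a * (p ^ k : ℕ)) = 1 := by
      rw [zpow_mul, ha, zpow_natCast, ← pow_mul, ← pow_succ', hexp]
    rw [← orderOf_dvd_iff_zpow_eq_one, hx, pow_succ', Nat.cast_mul] at h2
    have h3 : (p : ℤ) ∣ a :=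
      Int.dvd_of_mul_dvd_mul_right (by exact_mod_cast (pow_pos hp.pos k).ne') h2
    obtain ⟨b, rfl⟩ := h3
    refine ⟨y * (x ^ b)⁻¹, fun h => hy ?_, ?_⟩
    · exact (Subgroup.mul_mem_cancel_right _
        (Subgroup.inv_mem _ (Subgroup.zpow_mem _ (Subgroup.mem_zpowers x) b))).1 h
    · rw [mul_pow, ← ha, inv_pow, ← zpow_natCast (x ^ b), ← zpow_mul, mul_comm b, mul_inv_cancel]
  have hz : orderOf z = p := orderOf_eq_prime hzp fun h => hzx (h ▸ Subgroup.one_mem _)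
  have hzc : Nat.card (Subgroup.zpowers z) = p := by rw [Nat.card_zpowers, hz]
  have hdisj : Disjoint (Subgroup.zpowers z) (Subgroup.zpowers x) := by
    rw [disjoint_iff]
    have hdvd := hzc ▸ Subgroup.card_dvd_of_le
      (inf_le_left : Subgroup.zpowers z ⊓ Subgroup.zpowers x ≤ _)
    rcases (Nat.dvd_prime hp).1 hdvd with h | h
    · exact Subgroup.card_eq_one.1 h
    · have h1 : Subgroup.zpowers z ≤ Subgroup.zpowers z ⊓ Subgroup.zpowers x :=
        (Subgroup.eq_of_le_of_card_ge inf_le_left (by rw [h, hzc])).ge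
      exact absurd (h1 (Subgroup.mem_zpowers z)).2 hzx
  let f : Subgroup.zpowers z × Subgroup.zpowers x →* G :=
    (Subgroup.zpowers z).subtype.coprod (Subgroup.zpowers x).subtype
  have hf : Function.Bijective f := by
    rw [Nat.bijective_iff_injective_and_card]
    refine ⟨Subgroup.mul_injective_of_disjoint hdisj, ?_⟩
    rw [Nat.card_prod, hzc, hxc, hG, ← pow_succ']
  exact ⟨(MulEquiv.ofBijective f hf).symm.trans (MulEquiv.prodCongr
    (mulEquivOfCyclicCardEq (by rw [hzc, card_multiplicative_zmod]))
    (mulEquivOfCyclicCardEq (by rw [hxc, card_multiplicative_zmod])))⟩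

theorem stmt_9 (p n : ℕ) (hp : p.Prime) (hodd : Odd p) (hn : 4 ≤ n)
    (G : Type) [CommGroup G] [Finite G] (hcard : Nat.card G = p ^ n)
    (h1 : ¬ Nonempty (G ≃* Multiplicative (ZMod (p ^ n))))
    (h2 : ¬ Nonempty (G ≃* Multiplicative (ZMod p) × Multiplicative (ZMod (p ^ (n - 1))))) :
    beta (Multiplicative (ZMod (p ^ 2)) × Multiplicative (ZMod (p ^ (n - 2))))
      = (((n : ℝ) - 3) * (p : ℝ) ^ 2 + ((n : ℝ) - 1) * ((p : ℝ) + 1) + 2) / (p : ℝ) ^ n ∧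
    beta G ≥ (((n : ℝ) - 3) * (p : ℝ) ^ 2 + ((n : ℝ) - 1) * ((p : ℝ) + 1) + 2) / (p : ℝ) ^ n := by
  have : Fact p.Prime := ⟨hp⟩
  obtain ⟨m, rfl⟩ : ∃ m, n = m + 4 := ⟨n - 4, by omega⟩
  have hcast : ((m + 4 : ℕ) - 3 : ℝ) * (p : ℝ) ^ 2 + ((m + 4 : ℕ) - 1 : ℝ) * ((p : ℝ) + 1) + 2
      = (((m + 1) * p ^ 2 + (m + 3) * (p + 1) + 2 : ℕ) : ℝ) := by
    push_cast
    ring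
  rw [hcast]
  change beta (Multiplicative (ZMod (p ^ 2)) × Multiplicative (ZMod (p ^ (m + 2)))) = _ ∧ _
  simp only [beta]
  constructor
  · have hc : Nat.card (Multiplicative (ZMod (p ^ 2)) × Multiplicative (ZMod (p ^ (m + 2))))
        = p ^ (m + 4) := by
      rw [Nat.card_prod, card_multiplicative_zmod, card_multiplicative_zmod]
      ring
    have hupper := card_subgroup_prod_le_of_card_eq hp (m := m)
      (A := Multiplicative (ZMod (p ^ 2))) (B := Multiplicative (ZMod (p ^ (m + 2))))
      (card_multiplicative_zmod _) (card_multiplicative_zmod _)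
    have hlower := le_card_subgroup_of_pow_eq_one_of_four_le hp m hc (by
      rintro ⟨a, b⟩
      have ha : a ^ p ^ 2 = 1 :=
        orderOf_dvd_iff_pow_eq_one.1 ((orderOf_dvd_natCard a).trans
          (card_multiplicative_zmod _).dvd)
      have hb : b ^ p ^ (m + 2) = 1 :=
        orderOf_dvd_iff_pow_eq_one.1 ((orderOf_dvd_natCard b).trans
          (card_multiplicative_zmod _).dvd)
      refine Prod.ext ?_ hb
      change a ^ p ^ (m + 2) = 1
      rw [pow_add, mul_comm, pow_mul, ha, one_pow])
    rw [le_antisymm hupper hlower, hc, Nat.cast_pow]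
  · have hexp : ∀ x : G, x ^ p ^ (m + 2) = 1 := by
      intro x
      by_contra hx
      have hncyc : ¬ IsCyclic G := fun h =>
        h1 ⟨mulEquivOfCyclicCardEq (by rw [hcard, card_multiplicative_zmod])⟩
      obtain ⟨j, hj, hxj⟩ := (Nat.dvd_prime_pow hp).1 (hcard ▸ orderOf_dvd_natCard x)
      rw [← orderOf_dvd_iff_pow_eq_one, hxj, Nat.pow_dvd_pow_iff_le_right hp.one_lt] at hx
      obtain rfl | rfl : j = m + 3 ∨ j = m + 4 := by omega
      · exact (isCyclic_or_nonempty_mulEquiv_prod hp (k := m + 2) hcard hxj).elim hncyc h2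
      · exact hncyc (isCyclic_of_orderOf_eq_card x (by rw [hxj, hcard]))
    rw [hcard, Nat.cast_pow, ge_iff_le]
    gcongr
    exact le_card_subgroup_of_pow_eq_one_of_four_le hp m hcard hexp
end

section
/- Let (x_n)_{n≥1} be a sequence of positive real numbers such that x_n → 0 and the series ∑_{n=1}^∞ x_n diverges. Then the set of all sums ∑_{i∈I} x_i, where I ranges over the finite subsets of the index set, is dense in [0, ∞). -/
/-- If a nonnegative series diverges and all its terms are less than `ε`, then every `a ≥ 0` is
approximated from below within `ε` by a partial sum. -/
lemma exists_sum_range_mem_Ioc {y : ℕ → ℝ} (hy : ∀ n, 0 ≤ y n) (hdiv : ¬ Summable y)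
    {ε : ℝ} (hε : ∀ n, y n < ε) {a : ℝ} (ha : 0 ≤ a) :
    ∃ k, ∑ i ∈ Finset.range k, y i ∈ Set.Ioc (a - ε) a := by
  have htop := (not_summable_iff_tendsto_nat_atTop_of_nonneg hy).1 hdiv
  have hex : ∃ m, a < ∑ i ∈ Finset.range m, y i := (htop.eventually_gt_atTop a).exists
  classical
  obtain ⟨k, hk⟩ : ∃ k, Nat.find hex = k + 1 := by
    refine Nat.exists_eq_succ_of_ne_zero fun h => ?_
    have := Nat.find_spec hex
    rw [h, Finset.sum_range_zero] at this
    linarith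
  have hgt := Nat.find_spec hex
  have hle := not_lt.1 (Nat.find_min hex (m := k) (by omega))
  rw [hk, Finset.sum_range_succ] at hgt
  exact ⟨k, by linarith [hε k], hle⟩

theorem stmt_10 (x : ℕ → ℝ) (hpos : ∀ n, 0 < x n)
    (hlim : Filter.Tendsto x Filter.atTop (nhds 0))
    (hdiv : ¬ Summable x) :
    closure {s : ℝ | ∃ I : Finset ℕ, ∑ i ∈ I, x i = s} = Set.Ici (0 : ℝ) := by
  apply Set.Subset.antisymm
  · refine closure_minimal ?_ isClosed_Ici
    rintro _ ⟨I, rfl⟩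
    exact Finset.sum_nonneg fun i _ => (hpos i).le
  · intro a ha
    rw [Metric.mem_closure_iff]
    intro ε hε
    obtain ⟨N, hN⟩ := Filter.eventually_atTop.1 (hlim.eventually_lt_const hε)
    obtain ⟨k, hk⟩ := exists_sum_range_mem_Ioc (y := fun n => x (n + N))
      (fun n => (hpos _).le) (by rwa [summable_nat_add_iff])
      (fun n => hN _ (Nat.le_add_left N n)) ha
    refine ⟨_, ⟨(Finset.range k).map (addRightEmbedding N), Finset.sum_map _ _ _⟩, ?_⟩
    simp only [addRightEmbedding_apply]
    rw [Real.dist_eq, abs_lt]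
    constructor <;> linarith [hk.1, hk.2]
end

section
/- The set of real numbers of the form β(∏_{i∈I} Z_{p_i}^4), where I ranges over finite sets of indices and p_i denotes the i-th prime number, is dense in [1, ∞). -/
open Filter Topology Module

section SubspaceCount

variable {K V : Type*} [Field K] [AddCommGroup V] [Module K V]

/-- A linearly independent `k`-tuple is the same as a `k`-dimensional subspace together with a
linearly independent `k`-tuple in it. -/
noncomputable def linearIndependentEquivSigma [Finite V] (k : ℕ) :
    {s : Fin k → V // LinearIndependent K s} ≃
      Σ W : {W : Submodule K V // finrank K W = k}, {s : Fin k → W.1 // LinearIndependent K s} :=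
  Equiv.symm <| Equiv.ofBijective
    (fun x => ⟨fun i => (x.2.1 i : V), x.2.2.map' x.1.1.subtype (Submodule.ker_subtype _)⟩) <| by
  have span_eq (W : {W : Submodule K V // finrank K W = k})
      (s : {s : Fin k → W.1 // LinearIndependent K s}) :
      Submodule.span K (Set.range fun i => (s.1 i : V)) = W.1 := by
    have hli := s.2.map' W.1.subtype (Submodule.ker_subtype _)
    refine Submodule.eq_of_le_of_finrank_eq ?_ ?_
    · rw [Submodule.span_le]
      rintro _ ⟨i, rfl⟩
      exact (s.1 i).2
    · rw [W.2]
      exact (finrank_span_eq_card hli).trans (Fintype.card_fin k)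
  constructor
  · rintro ⟨W, s⟩ ⟨W', s'⟩ h
    have h' : (fun i => (s.1 i : V)) = fun i => (s'.1 i : V) := congrArg Subtype.val h
    obtain rfl : W = W' := Subtype.ext (by rw [← span_eq W s, ← span_eq W' s', h'])
    congr
    ext i
    exact congrFun h' i
  · rintro ⟨s, hs⟩
    refine ⟨⟨⟨Submodule.span K (Set.range s), ?_⟩,
      ⟨fun i => ⟨s i, Submodule.subset_span ⟨i, rfl⟩⟩, ?_⟩⟩, rfl⟩
    · exact (finrank_span_eq_card hs).trans (Fintype.card_fin k)
    · exact LinearIndependent.of_comp (Submodule.subtype _) hs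

theorem card_submodule_finrank_mul [Fintype K] [Finite V] {k : ℕ} (hk : k ≤ finrank K V) :
    Nat.card {W : Submodule K V // finrank K W = k} *
        ∏ i : Fin k, (Fintype.card K ^ k - Fintype.card K ^ i.val) =
      ∏ i : Fin k, (Fintype.card K ^ finrank K V - Fintype.card K ^ i.val) := by
  classical
  have := Fintype.ofFinite {W : Submodule K V // finrank K W = k}
  rw [← card_linearIndependent hk, Nat.card_congr (linearIndependentEquivSigma k), Nat.card_sigma]
  rw [Finset.sum_congr rfl fun W _ => card_linearIndependent (K := K) W.2.ge]
  rw [Finset.sum_congr rfl fun W _ => by rw [W.2]]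
  simp [Nat.card_eq_fintype_card]

theorem card_submodule_finrank_eq_of_mul_eq [Fintype K] [Finite V] {k : ℕ} (hk : k ≤ finrank K V)
    {c : ℤ} (hc : c * ∏ i : Fin k, ((Fintype.card K : ℤ) ^ k - (Fintype.card K : ℤ) ^ i.val) =
      ∏ i : Fin k, ((Fintype.card K : ℤ) ^ finrank K V - (Fintype.card K : ℤ) ^ i.val)) :
    (Nat.card {W : Submodule K V // finrank K W = k} : ℤ) = c := by
  have hq : 1 < Fintype.card K := Fintype.one_lt_card
  have hcast {m : ℕ} (hm : k ≤ m) :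
      ((∏ i : Fin k, (Fintype.card K ^ m - Fintype.card K ^ i.val) : ℕ) : ℤ) =
        ∏ i : Fin k, ((Fintype.card K : ℤ) ^ m - (Fintype.card K : ℤ) ^ i.val) := by
    rw [Nat.cast_prod]
    refine Finset.prod_congr rfl fun i _ => ?_
    rw [Nat.cast_sub (Nat.pow_le_pow_right hq.le (i.2.le.trans hm)), Nat.cast_pow, Nat.cast_pow]
  have hmul := congrArg (Nat.cast (R := ℤ)) (card_submodule_finrank_mul hk)
  rw [Nat.cast_mul, hcast le_rfl, hcast hk, ← hc] at hmul
  refine mul_right_cancel₀ (Finset.prod_ne_zero_iff.2 fun i _ => sub_ne_zero.2 ?_) hmul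
  exact (pow_lt_pow_right₀ (by exact_mod_cast hq) i.2).ne'

theorem card_submodule_of_finrank_eq_four [Fintype K] [Finite V] (hV : finrank K V = 4) :
    Nat.card (Submodule K V) = Fintype.card K ^ 4 + 3 * Fintype.card K ^ 3 +
      4 * Fintype.card K ^ 2 + 3 * Fintype.card K + 5 := by
  classical
  have hsum : Nat.card (Submodule K V) =
      ∑ k : Fin 5, Nat.card {W : Submodule K V // finrank K W = k} := by
    let f : Submodule K V → Fin 5 := fun W =>
      ⟨finrank K W, Nat.lt_succ_of_le (hV ▸ Submodule.finrank_le W)⟩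
    rw [← Nat.card_congr (Equiv.sigmaFiberEquiv f), Nat.card_sigma]
    refine Finset.sum_congr rfl fun k _ => Nat.card_congr (Equiv.subtypeEquivRight fun W => ?_)
    simp [f, Fin.ext_iff]
  set q := Fintype.card K
  have h0 : (Nat.card {W : Submodule K V // finrank K W = 0} : ℤ) = 1 :=
    card_submodule_finrank_eq_of_mul_eq (by lia) (by simp [hV])
  have h1 : (Nat.card {W : Submodule K V // finrank K W = 1} : ℤ) = q ^ 3 + q ^ 2 + q + 1 :=
    card_submodule_finrank_eq_of_mul_eq (by lia) (by simp [hV]; ring)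
  have h2 : (Nat.card {W : Submodule K V // finrank K W = 2} : ℤ) = (q ^ 2 + 1) * (q ^ 2 + q + 1) :=
    card_submodule_finrank_eq_of_mul_eq (by lia) (by simp [hV, Fin.prod_univ_succ]; ring)
  have h3 : (Nat.card {W : Submodule K V // finrank K W = 3} : ℤ) = q ^ 3 + q ^ 2 + q + 1 :=
    card_submodule_finrank_eq_of_mul_eq (by lia) (by simp [hV, Fin.prod_univ_succ]; ring)
  have h4 : (Nat.card {W : Submodule K V // finrank K W = 4} : ℤ) = 1 :=
    card_submodule_finrank_eq_of_mul_eq (by lia) (by simp [hV, Fin.prod_univ_succ])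
  apply Nat.cast_injective (R := ℤ)
  rw [hsum, Fin.sum_univ_five]
  push_cast
  simp only [Fin.coe_ofNat_eq_mod, Nat.reduceMod, h0, h1, h2, h3, h4]
  ring

end SubspaceCount

section CoprimeProduct

variable {ι : Type*} [Fintype ι] {G : ι → Type*} [∀ i, Group (G i)]

theorem Subgroup.mulSingle_mem_of_coprime [DecidableEq ι] {n : ι → ℕ}
    (hn : Pairwise (Function.onFun Nat.Coprime n)) (hG : ∀ i (g : G i), g ^ n i = 1)
    (H : Subgroup (∀ i, G i)) {h : ∀ i, G i} (hh : h ∈ H) (i : ι) :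
    Pi.mulSingle i (h i) ∈ H := by
  set N := ∏ j ∈ Finset.univ.erase i, n j
  have hcop : Nat.Coprime N (n i) :=
    Nat.Coprime.prod_left fun j hj => hn (Finset.ne_of_mem_erase hj)
  obtain ⟨m, hm0, hm1⟩ : ∃ m, m ≡ 0 [MOD N] ∧ m ≡ 1 [MOD n i] :=
    ⟨_, (Nat.chineseRemainder hcop 0 1).2⟩
  convert H.pow_mem hh m
  ext j
  by_cases hj : j = i
  · subst hj
    have hord : orderOf (h j) ∣ n j := orderOf_dvd_of_pow_eq_one (hG j _)
    rw [Pi.mulSingle_eq_same, Pi.pow_apply]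
    simpa using (pow_eq_pow_iff_modEq.2 (hm1.of_dvd hord)).symm
  · rw [Pi.mulSingle_eq_of_ne hj, Pi.pow_apply]
    have hjN : n j ∣ N := Finset.dvd_prod_of_mem n (by simp [hj])
    obtain ⟨c, rfl⟩ := hjN.trans (Nat.modEq_zero_iff_dvd.1 hm0)
    rw [pow_mul, hG, one_pow]

theorem card_subgroup_pi_of_coprime {n : ι → ℕ}
    (hn : Pairwise (Function.onFun Nat.Coprime n)) (hG : ∀ i (g : G i), g ^ n i = 1) :
    Nat.card (Subgroup (∀ i, G i)) = ∏ i, Nat.card (Subgroup (G i)) := by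
  classical
  rw [← Nat.card_pi]
  refine (Nat.card_congr (Equiv.ofBijective (Subgroup.pi Set.univ) ⟨?_, ?_⟩)).symm
  · intro A B hAB
    ext i x
    have := congrArg (Pi.mulSingle i x ∈ ·) hAB
    simpa [Subgroup.mulSingle_mem_pi] using this
  · intro H
    refine ⟨fun i => H.map (Pi.evalMonoidHom G i), le_antisymm ?_ ?_⟩
    · rw [Subgroup.pi_le_iff]
      intro i
      rintro _ ⟨_, ⟨h, hh, rfl⟩, rfl⟩
      exact H.mulSingle_mem_of_coprime hn hG hh i
    · rw [Subgroup.le_pi_iff]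
      intro i _
      exact Subgroup.map_le_iff_le_comap.1 le_rfl

theorem beta_pi_of_coprime {n : ι → ℕ}
    (hn : Pairwise (Function.onFun Nat.Coprime n)) (hG : ∀ i (g : G i), g ^ n i = 1) :
    beta (∀ i, G i) = ∏ i, beta (G i) := by
  simp only [beta]
  rw [card_subgroup_pi_of_coprime hn hG, Nat.card_pi, Finset.prod_div_distrib]
  push_cast
  rfl

end CoprimeProduct

theorem beta_elementaryAbelian_four (p : ℕ) [Fact p.Prime] :
    beta (Fin 4 → Multiplicative (ZMod p)) = 1 + 3 / p + 4 / p ^ 2 + 3 / p ^ 3 + 5 / p ^ 4 := by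
  have hp : (p : ℝ) ≠ 0 := by exact_mod_cast (Fact.out : p.Prime).ne_zero
  have hcard : Nat.card (Subgroup (Fin 4 → Multiplicative (ZMod p))) =
      p ^ 4 + 3 * p ^ 3 + 4 * p ^ 2 + 3 * p + 5 := by
    rw [Nat.card_congr ((MulEquiv.piMultiplicative fun _ : Fin 4 => ZMod p).symm.mapSubgroup.trans
      (AddSubgroup.toSubgroup.symm.trans (AddSubgroup.toZModSubmodule p))).toEquiv,
      card_submodule_of_finrank_eq_four (by simp), ZMod.card]
  have hcard' : Nat.card (Fin 4 → Multiplicative (ZMod p)) = p ^ 4 := by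
    rw [Nat.card_pi]
    simp
  rw [beta, hcard, hcard']
  push_cast
  field_simp

theorem one_add_sum_sub_one_le_prod {ι : Type*} (s : Finset ι) {b : ι → ℝ} (hb : ∀ i, 1 ≤ b i) :
    1 + ∑ i ∈ s, (b i - 1) ≤ ∏ i ∈ s, b i := by
  classical
  induction s using Finset.induction_on with
  | empty => simp
  | insert a s ha ih =>
    rw [Finset.sum_insert ha, Finset.prod_insert ha]
    have hsum : 0 ≤ ∑ i ∈ s, (b i - 1) := Finset.sum_nonneg fun i _ => sub_nonneg.2 (hb i)
    nlinarith [hb a]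

/-- Finite products of a sequence of factors that are at least one, tend to one and have divergent
product are dense in `[1, ∞)`. -/
theorem closure_range_prod_eq_Ici {b : ℕ → ℝ} (hb : ∀ i, 1 ≤ b i) (hlim : Tendsto b atTop (𝓝 1))
    (hdiv : ¬ Summable fun i => b i - 1) :
    closure (Set.range fun I : Finset ℕ => ∏ i ∈ I, b i) = Set.Ici 1 := by
  refine (closure_minimal ?_ isClosed_Ici).antisymm fun x hx => ?_
  · rintro _ ⟨I, rfl⟩
    exact Finset.prod_induction b (1 ≤ ·) (fun _ _ => one_le_mul_of_one_le_of_one_le) le_rfl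
      fun i _ => hb i
  rw [Set.mem_Ici] at hx
  rw [Metric.mem_closure_range_iff]
  intro ε hε
  have hδ : 0 < ε / x := by positivity
  obtain ⟨N, hN⟩ := Metric.tendsto_atTop.1 hlim _ hδ
  have hdivN : Tendsto (fun m => ∑ i ∈ Finset.range m, (b (i + N) - 1)) atTop atTop := by
    rw [← not_summable_iff_tendsto_nat_atTop_of_nonneg fun i => sub_nonneg.2 (hb _)]
    rwa [summable_nat_add_iff (f := fun i => b i - 1)]
  have hex : ∃ m, x < ∏ i ∈ Finset.range m, b (i + N) := by
    obtain ⟨m, hm⟩ := (hdivN.eventually_gt_atTop x).exists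
    have hle := one_add_sum_sub_one_le_prod (Finset.range m) fun i => hb (i + N)
    exact ⟨m, by linarith⟩
  obtain ⟨m, hm, hmin⟩ : ∃ m, x < ∏ i ∈ Finset.range (m + 1), b (i + N) ∧
      ∏ i ∈ Finset.range m, b (i + N) ≤ x := by
    classical
    cases hfind : Nat.find hex with
    | zero =>
      have := Nat.find_spec hex
      simp [hfind] at this
      linarith
    | succ m =>
      exact ⟨m, hfind ▸ Nat.find_spec hex, not_lt.1 (Nat.find_min hex (by lia))⟩
  refine ⟨(Finset.range m).map (addRightEmbedding N), ?_⟩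
  simp only [Finset.prod_map, addRightEmbedding_apply]
  rw [Finset.prod_range_succ] at hm
  have hbm := hN (m + N) (by lia)
  rw [Real.dist_eq, abs_of_nonneg (sub_nonneg.2 (hb _)), lt_div_iff₀ (by linarith)] at hbm
  rw [Real.dist_eq, abs_of_nonneg (sub_nonneg.2 hmin)]
  nlinarith [hb (m + N)]

theorem not_summable_inv_nth_prime : ¬ Summable fun i => (1 : ℝ) / Nat.nth Nat.Prime i := by
  have h := not_summable_one_div_on_primes
  rw [← (Nat.nth_injective Nat.infinite_setOfPred_prime).summable_iff] at h
  · convert h using 2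
    ext i
    simp [Nat.prime_nth_prime]
  · intro x hx
    rw [Nat.range_nth_of_infinite Nat.infinite_setOfPred_prime] at hx
    exact Set.indicator_of_notMem hx _

theorem stmt_12 :
    closure {x : ℝ | ∃ I : Finset ℕ,
      beta (∀ i : I, Fin 4 → Multiplicative (ZMod (Nat.nth Nat.Prime i))) = x}
      = Set.Ici (1 : ℝ) := by
  have hprime (i : ℕ) : Fact (Nat.nth Nat.Prime i).Prime := ⟨Nat.prime_nth_prime i⟩
  set b : ℕ → ℝ := fun i => beta (Fin 4 → Multiplicative (ZMod (Nat.nth Nat.Prime i))) with hb_def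
  have hb (i : ℕ) := beta_elementaryAbelian_four (Nat.nth Nat.Prime i)
  have hinj := Nat.nth_injective Nat.infinite_setOfPred_prime
  have hprod (I : Finset ℕ) :
      beta (∀ i : I, Fin 4 → Multiplicative (ZMod (Nat.nth Nat.Prime i))) = ∏ i ∈ I, b i := by
    rw [beta_pi_of_coprime (n := fun i : I => Nat.nth Nat.Prime i), Finset.prod_coe_sort I b]
    · intro i j hij
      exact (Nat.coprime_primes (hprime i).out (hprime j).out).2
        (hinj.ne (Subtype.coe_injective.ne hij))
    · intro i g
      funext k
      have := pow_card_eq_one' (x := g k)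
      rwa [Nat.card_congr Multiplicative.toAdd, Nat.card_zmod] at this
  simp only [hprod]
  refine closure_range_prod_eq_Ici (fun i => ?_) ?_ fun h => ?_
  · simp only [hb_def, hb, add_assoc]
    exact le_add_of_nonneg_right (by positivity)
  · have hinv : Tendsto (fun i => ((Nat.nth Nat.Prime i : ℕ) : ℝ)⁻¹) atTop (𝓝 0) :=
      tendsto_inv_atTop_zero.comp (tendsto_natCast_atTop_atTop.comp
        (Nat.nth_strictMono Nat.infinite_setOfPred_prime).tendsto_atTop)
    have := ((((hinv.const_mul 3).const_add 1).add ((hinv.pow 2).const_mul 4)).add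
      ((hinv.pow 3).const_mul 3)).add ((hinv.pow 4).const_mul 5)
    simpa [hb_def, hb, div_eq_mul_inv] using this
  · refine not_summable_inv_nth_prime (h.of_nonneg_of_le (fun i => by positivity) fun i => ?_)
    have h2 : (0 : ℝ) ≤ 1 / Nat.nth Nat.Prime i := by positivity
    have h3 : (0 : ℝ) ≤ 4 / Nat.nth Nat.Prime i ^ 2 + 3 / Nat.nth Nat.Prime i ^ 3 +
      5 / Nat.nth Nat.Prime i ^ 4 := by positivity
    simp only [hb_def, hb]
    linear_combination 2 * h2 + h3
end

section
/- Let p ≥ 5 be a prime, n ≥ 3 an integer, and G an abelian p-group of rank 3 and order p^n, i.e., G ≅ Z_{p^{d_1}} × Z_{p^{d_2}} × Z_{p^{d_3}} with 1 ≤ d_1 ≤ d_2 ≤ d_3 and d_1 + d_2 + d_3 = n. Then β(G) < 1. -/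
open Finset in
/-- Grouping a sum according to the fibres of `f`, when the summand is a function of `f`. -/
lemma sum_comp_le_sum_mul {α β : Type*} [Fintype α] [Fintype β] (f : α → β) (w m : β → ℕ)
    (hm : ∀ b, Nat.card {a // f a = b} ≤ m b) :
    ∑ a, w (f a) ≤ ∑ b, w b * m b := by
  classical
  rw [← Finset.sum_fiberwise' univ f w]
  refine Finset.sum_le_sum fun b _ => ?_
  rw [Finset.sum_const, smul_eq_mul, mul_comm]
  refine Nat.mul_le_mul_left _ ((hm b).trans' ?_)
  rw [Nat.card_eq_fintype_card, Fintype.card_subtype]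

namespace Subgroup

lemma index_mem_divisors {C : Type*} [Group C] [Finite C] (H : Subgroup C) :
    H.index ∈ (Nat.card C).divisors :=
  Nat.mem_divisors.2 ⟨H.index_dvd_card, Nat.card_pos.ne'⟩

section Cyclic

variable {C : Type*} [CommGroup C] [Finite C] [IsCyclic C]

lemma eq_ker_powMonoidHom_card (H : Subgroup C) :
    H = (powMonoidHom (Nat.card H) : C →* C).ker := by
  refine eq_of_le_of_card_ge (fun x hx => ?_) ?_
  · have h := pow_card_eq_one' (x := (⟨x, hx⟩ : H))
    exact congrArg Subtype.val h
  · rw [IsCyclic.card_powMonoidHom_ker]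
    exact Nat.gcd_le_right _ Nat.card_pos

lemma index_injective_of_isCyclic : Function.Injective (index : Subgroup C → ℕ) := by
  intro H K h
  have hH := H.card_mul_index
  rw [← K.card_mul_index, h] at hH
  have hcard := Nat.eq_of_mul_eq_mul_right (Nat.pos_of_ne_zero index_ne_zero_of_finite) hH
  rw [eq_ker_powMonoidHom_card H, eq_ker_powMonoidHom_card K, hcard]

lemma card_le_card_divisors_of_isCyclic :
    Nat.card (Subgroup C) ≤ (Nat.card C).divisors.card := by
  have := Fintype.ofFinite (Subgroup C)
  rw [Nat.card_eq_fintype_card]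
  exact Finset.card_le_card_of_injOn index (fun H _ => index_mem_divisors H)
    index_injective_of_isCyclic.injOn

lemma sum_index_le_sum_divisors_of_isCyclic [Fintype (Subgroup C)] :
    ∑ H : Subgroup C, H.index ≤ ∑ d ∈ (Nat.card C).divisors, d := by
  classical
  rw [← Finset.sum_image (f := fun d : ℕ => d) index_injective_of_isCyclic.injOn]
  refine Finset.sum_le_sum_of_subset fun d hd => ?_
  obtain ⟨H, -, rfl⟩ := Finset.mem_image.1 hd
  exact index_mem_divisors H

end Cyclic

variable {A C : Type*} [CommGroup A] [CommGroup C]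

/-- The intersection with the first factor and the projection to the second factor. -/
def interProj (K : Subgroup (A × C)) : Subgroup A × Subgroup C :=
  (K.comap (MonoidHom.inl A C), K.map (MonoidHom.snd A C))

lemma index_eq_mul_index_interProj (K : Subgroup (A × C)) :
    K.index = K.interProj.1.index * K.interProj.2.index := by
  have hrange : (MonoidHom.inl A C).range = (MonoidHom.snd A C).ker := by
    ext ⟨a, c⟩
    simp [MonoidHom.ker_snd, mem_prod, eq_comm]
  simp only [interProj]
  rw [index_comap, index_map, hrange, ← relIndex_sup_left,
    MonoidHom.range_eq_top.2 Prod.snd_surjective, index_top, mul_one,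
    sup_comm, relIndex_mul_index le_sup_right]

lemma le_of_interProj_fst_eq {K K' : Subgroup (A × C)} {a a' : A} {g : C}
    (hfst : K.interProj.1 = K'.interProj.1) (hsnd : K.interProj.2 ≤ zpowers g)
    (ha : (a, g) ∈ K) (ha' : (a', g) ∈ K') (haa : a'⁻¹ * a ∈ K.interProj.1) : K ≤ K' := by
  have hmem : ∀ x : A, (x, (1 : C)) ∈ K → (x, (1 : C)) ∈ K' := fun x hx => by
    have : x ∈ K.interProj.1 := hx
    rwa [hfst] at this
  have hag : (a, g) ∈ K' := by
    simpa using K'.mul_mem ha' (hmem _ haa)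
  rintro ⟨b, c⟩ hbc
  obtain ⟨n, rfl⟩ := mem_zpowers_iff.1 (hsnd ⟨(b, c), hbc, rfl⟩)
  have h := hmem (b * (a ^ n)⁻¹) (by simpa using K.mul_mem hbc (K.inv_mem (K.zpow_mem ha n)))
  simpa using K'.mul_mem h (K'.zpow_mem hag n)

/-- A subgroup of `A × C` with `C` cyclic is determined by its intersection `L` with `A`, its
projection `D` to `C`, and an element of `A ⧸ L` killed by the order of `D`. -/
lemma card_interProj_fiber_le [Finite A] [IsCyclic C] (L : Subgroup A) (D : Subgroup C) :
    Nat.card {K : Subgroup (A × C) // K.interProj = (L, D)} ≤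
      Nat.card {x : A ⧸ L // x ^ Nat.card D = 1} := by
  obtain ⟨g, rfl⟩ := Subgroup.isCyclic_iff_exists_zpowers_eq_top D |>.1 inferInstance
  have hex : ∀ K : {K : Subgroup (A × C) // K.interProj = (L, zpowers g)},
      ∃ a, (a, g) ∈ K.1 := by
    rintro ⟨K, hK⟩
    have hg : g ∈ K.interProj.2 := by rw [hK]; exact mem_zpowers g
    obtain ⟨⟨a, _⟩, ha, rfl⟩ := hg
    exact ⟨a, ha⟩
  choose a ha using hex
  have hpow : ∀ K, (a K : A ⧸ L) ^ Nat.card (zpowers g) = 1 := fun K => by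
    rw [← QuotientGroup.mk_pow, QuotientGroup.eq_one_iff, Nat.card_zpowers]
    have : a K ^ orderOf g ∈ K.1.interProj.1 := by
      have h := K.1.pow_mem (ha K) (orderOf g)
      rwa [Prod.pow_mk, pow_orderOf_eq_one] at h
    rwa [K.2] at this
  refine Nat.card_le_card_of_injective (fun K => ⟨(a K : A ⧸ L), hpow K⟩) fun K K' h => ?_
  have hq : (a K : A ⧸ L) = a K' := congrArg Subtype.val h
  refine Subtype.ext (le_antisymm ?_ ?_)
  · exact le_of_interProj_fst_eq (by rw [K.2, K'.2]) (by rw [K.2]) (ha K) (ha K')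
      (by rw [K.2]; exact QuotientGroup.eq.1 hq.symm)
  · exact le_of_interProj_fst_eq (by rw [K.2, K'.2]) (by rw [K'.2]) (ha K') (ha K)
      (by rw [K'.2]; exact QuotientGroup.eq.1 hq)

lemma card_prod_le_of_isCyclic [Finite A] [Finite C] [IsCyclic C] [Fintype (Subgroup A)] :
    Nat.card (Subgroup (A × C)) ≤ Nat.card (Subgroup C) * ∑ L : Subgroup A, L.index := by
  have := Fintype.ofFinite (Subgroup (A × C))
  have := Fintype.ofFinite (Subgroup C)
  have h := sum_comp_le_sum_mul (interProj (A := A) (C := C)) (fun _ => 1) (fun q => q.1.index)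
    fun q => (card_interProj_fiber_le q.1 q.2).trans
      (Nat.card_le_card_of_injective _ Subtype.val_injective)
  simpa [Fintype.sum_prod_type_right, Nat.card_eq_fintype_card] using h

lemma sum_index_prod_le_of_isCyclic [Finite A] [IsCyclic A] [Finite C] [IsCyclic C]
    [Fintype (Subgroup A)] [Fintype (Subgroup (A × C))] :
    ∑ K : Subgroup (A × C), K.index ≤
      Nat.card (Subgroup C) * Nat.card C * ∑ L : Subgroup A, L.index := by
  have := Fintype.ofFinite (Subgroup C)
  have hfiber : ∀ q : Subgroup A × Subgroup C,
      Nat.card {K : Subgroup (A × C) // K.interProj = q} ≤ Nat.card q.2 := by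
    rintro ⟨L, D⟩
    refine (card_interProj_fiber_le L D).trans ?_
    have : IsCyclic (A ⧸ L) :=
      isCyclic_of_surjective (QuotientGroup.mk' L) (QuotientGroup.mk'_surjective L)
    have h : Nat.card (powMonoidHom (Nat.card D) : A ⧸ L →* A ⧸ L).ker ≤ Nat.card D := by
      rw [IsCyclic.card_powMonoidHom_ker]
      exact Nat.gcd_le_right _ Nat.card_pos
    exact h
  calc ∑ K : Subgroup (A × C), K.index
      = ∑ K : Subgroup (A × C), K.interProj.1.index * K.interProj.2.index :=
        Finset.sum_congr rfl fun K _ => K.index_eq_mul_index_interProj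
    _ ≤ ∑ q : Subgroup A × Subgroup C, q.1.index * q.2.index * Nat.card q.2 :=
        sum_comp_le_sum_mul interProj (fun q => q.1.index * q.2.index) _ hfiber
    _ = ∑ q : Subgroup A × Subgroup C, q.1.index * Nat.card C :=
        Finset.sum_congr rfl fun q _ => by
          rw [mul_assoc, mul_comm q.2.index, card_mul_index]
    _ = _ := by
        simp only [Fintype.sum_prod_type_right]
        rw [Finset.sum_const, ← Finset.sum_mul, Finset.card_univ,
          smul_eq_mul, Nat.card_eq_fintype_card (α := Subgroup C)]
        ring

end Subgroup

lemma succ_sq_mul_le_pred_mul_pow {p d : ℕ} (hp : 5 ≤ p) (hd : 1 ≤ d) :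
    (d + 1) ^ 2 * p ≤ (p - 1) * p ^ d := by
  induction d, hd using Nat.le_induction with
  | base =>
    rw [pow_one]
    exact Nat.mul_le_mul_right _ (by omega)
  | succ d hd ih =>
    calc (d + 1 + 1) ^ 2 * p ≤ 5 * (d + 1) ^ 2 * p := Nat.mul_le_mul_right _ (by nlinarith)
      _ ≤ p * ((d + 1) ^ 2 * p) := by rw [mul_assoc]; exact Nat.mul_le_mul_right _ hp
      _ ≤ p * ((p - 1) * p ^ d) := Nat.mul_le_mul_left _ ih
      _ = (p - 1) * p ^ (d + 1) := by ring

lemma mul_geom_sum_lt_pow {p a b c : ℕ} (hp : 5 ≤ p) (hc : 1 ≤ c) (hac : a ≤ c) :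
    (c + 1) * ((a + 1) * p ^ a * ∑ i ∈ Finset.range (b + 1), p ^ i) < p ^ a * p ^ b * p ^ c := by
  have hpos : 0 < p := by omega
  have hgeom : (p - 1) * ∑ i ∈ Finset.range (b + 1), p ^ i < p ^ b * p := by
    rw [Nat.geomSum_eq (by omega), Nat.mul_div_cancel' (Nat.sub_one_dvd_pow_sub_one p (b + 1)),
      ← pow_succ]
    exact Nat.sub_lt (by positivity) one_pos
  have hca : (c + 1) * (a + 1) * p ≤ (p - 1) * p ^ c :=
    (Nat.mul_le_mul_right _ (by nlinarith)).trans (succ_sq_mul_le_pred_mul_pow hp hc)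
  refine Nat.lt_of_mul_lt_mul_left (a := p - 1) ?_
  calc (p - 1) * ((c + 1) * ((a + 1) * p ^ a * ∑ i ∈ Finset.range (b + 1), p ^ i))
      = (c + 1) * (a + 1) * p ^ a * ((p - 1) * ∑ i ∈ Finset.range (b + 1), p ^ i) := by ring
    _ < (c + 1) * (a + 1) * p ^ a * (p ^ b * p) := Nat.mul_lt_mul_of_pos_left hgeom (by positivity)
    _ = (c + 1) * (a + 1) * p * (p ^ a * p ^ b) := by ring
    _ ≤ (p - 1) * p ^ c * (p ^ a * p ^ b) := Nat.mul_le_mul_right _ hca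
    _ = (p - 1) * (p ^ a * p ^ b * p ^ c) := by ring

theorem stmt_17 (p n d1 d2 d3 : ℕ) (hp : p.Prime) (hp5 : 5 ≤ p) (hn : 3 ≤ n)
    (h1 : 1 ≤ d1) (h12 : d1 ≤ d2) (h23 : d2 ≤ d3) (hsum : d1 + d2 + d3 = n)
    (G : Type) [CommGroup G]
    (hG : Nonempty (G ≃* Multiplicative (ZMod (p ^ d1)) × Multiplicative (ZMod (p ^ d2)) ×
      Multiplicative (ZMod (p ^ d3)))) :
    beta G < 1 := by
  obtain ⟨e⟩ := hG
  have : NeZero p := ⟨hp.ne_zero⟩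
  let Z (d : ℕ) : Type := Multiplicative (ZMod (p ^ d))
  have hZ (d : ℕ) : Nat.card (Z d) = p ^ d := Nat.card_zmod _
  have hsub (d : ℕ) : Nat.card (Subgroup (Z d)) ≤ d + 1 := by
    refine Subgroup.card_le_card_divisors_of_isCyclic.trans ?_
    rw [hZ, Nat.divisors_prime_pow hp, Finset.card_map, Finset.card_range]
  let e' : G ≃* (Z d2 × Z d1) × Z d3 :=
    e.trans (MulEquiv.prodAssoc.symm.trans (MulEquiv.prodComm.prodCongr (MulEquiv.refl _)))
  have hcardG : Nat.card G = p ^ d1 * p ^ d2 * p ^ d3 := by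
    rw [Nat.card_congr e'.toEquiv, Nat.card_prod, Nat.card_prod, hZ, hZ, hZ, mul_comm (p ^ d2)]
  have := Fintype.ofFinite (Subgroup (Z d2))
  have := Fintype.ofFinite (Subgroup (Z d2 × Z d1))
  have hindex : ∑ L : Subgroup (Z d2), L.index ≤ ∑ i ∈ Finset.range (d2 + 1), p ^ i := by
    refine Subgroup.sum_index_le_sum_divisors_of_isCyclic.trans ?_
    rw [hZ, Nat.sum_divisors_prime_pow hp]
  have hlt : Nat.card (Subgroup G) < Nat.card G := by
    rw [hcardG, Nat.card_congr e'.mapSubgroup.toEquiv]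
    refine lt_of_le_of_lt ?_ (mul_geom_sum_lt_pow hp5 (by omega) (h12.trans h23))
    refine Subgroup.card_prod_le_of_isCyclic.trans (Nat.mul_le_mul (hsub d3) ?_)
    refine Subgroup.sum_index_prod_le_of_isCyclic.trans (Nat.mul_le_mul ?_ hindex)
    exact Nat.mul_le_mul (hsub d1) (hZ d1).le
  rw [beta, div_lt_one (by exact_mod_cast Nat.zero_lt_of_lt hlt)]
  exact_mod_cast hlt
end

section
/- Let p be a prime and G a finite abelian p-group. Then β(H) ≤ 1 for every subgroup H of G if and only if one of the following holds: G is cyclic; G has rank 2 and p ≥ 3; or G has rank 3 and p ≥ 5. -/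
section Graph

variable {A B : Type*} [AddCommGroup A] [AddCommGroup B]

/-- The subgroup of `A × B` of all `(a, b)` with `a ∈ C` and `f a = b + L`. -/
def graphSubgroup (C : AddSubgroup A) (L : AddSubgroup B) (f : C →+ B ⧸ L) :
    AddSubgroup (A × B) where
  carrier := {x | ∃ h : x.1 ∈ C, f ⟨x.1, h⟩ = (x.2 : B ⧸ L)}
  zero_mem' := ⟨C.zero_mem, map_zero f⟩
  add_mem' := by
    rintro x y ⟨hx, hfx⟩ ⟨hy, hfy⟩
    refine ⟨C.add_mem hx hy, ?_⟩
    have := map_add f ⟨x.1, hx⟩ ⟨y.1, hy⟩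
    rw [hfx, hfy] at this
    exact this
  neg_mem' := by
    rintro x ⟨hx, hfx⟩
    refine ⟨C.neg_mem hx, ?_⟩
    have := map_neg f ⟨x.1, hx⟩
    rw [hfx] at this
    exact this

theorem mem_graphSubgroup {C : AddSubgroup A} {L : AddSubgroup B} {f : C →+ B ⧸ L} {x : A × B} :
    x ∈ graphSubgroup C L f ↔ ∃ h : x.1 ∈ C, f ⟨x.1, h⟩ = (x.2 : B ⧸ L) :=
  Iff.rfl

theorem fst_graphSubgroup (C : AddSubgroup A) (L : AddSubgroup B) (f : C →+ B ⧸ L) :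
    (graphSubgroup C L f).map (AddMonoidHom.fst A B) = C := by
  ext a
  simp only [AddSubgroup.mem_map, mem_graphSubgroup]
  constructor
  · rintro ⟨x, ⟨h, -⟩, rfl⟩
    exact h
  · intro h
    obtain ⟨b, hb⟩ := QuotientAddGroup.mk_surjective (f ⟨a, h⟩)
    exact ⟨(a, b), ⟨h, hb.symm⟩, rfl⟩

theorem inr_graphSubgroup (C : AddSubgroup A) (L : AddSubgroup B) (f : C →+ B ⧸ L) :
    (graphSubgroup C L f).comap (AddMonoidHom.inr A B) = L := by
  ext b
  simp only [AddSubgroup.mem_comap, mem_graphSubgroup, AddMonoidHom.inr_apply]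
  constructor
  · rintro ⟨h, hb⟩
    exact (QuotientAddGroup.eq_zero_iff b).1 (hb.symm.trans (map_zero f))
  · intro h
    exact ⟨C.zero_mem, (map_zero f).trans ((QuotientAddGroup.eq_zero_iff b).2 h).symm⟩

theorem graphSubgroup_bijective : Function.Bijective
    (fun t : Σ C : AddSubgroup A, Σ L : AddSubgroup B, (C →+ B ⧸ L) =>
      graphSubgroup t.1 t.2.1 t.2.2) := by
  constructor
  · rintro ⟨C, L, f⟩ ⟨C', L', f'⟩ h
    simp only at h
    obtain rfl : C = C' := by rw [← fst_graphSubgroup C L f, h, fst_graphSubgroup]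
    obtain rfl : L = L' := by rw [← inr_graphSubgroup C L f, h, inr_graphSubgroup]
    congr 2
    ext c
    obtain ⟨b, hb⟩ := QuotientAddGroup.mk_surjective (f c)
    have hmem : ((c : A), b) ∈ graphSubgroup C L f' := h ▸ ⟨c.2, hb.symm⟩
    exact hb.symm.trans hmem.choose_spec.symm
  · intro K
    let C := K.map (AddMonoidHom.fst A B)
    let L := K.comap (AddMonoidHom.inr A B)
    have hC : ∀ c : C, ∃ b, ((c : A), b) ∈ K := by
      rintro ⟨c, ⟨x, hx, rfl⟩⟩
      exact ⟨x.2, hx⟩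
    choose s hs using hC
    have key : ∀ a b b', (a, b) ∈ K → (a, b') ∈ K → (b : B ⧸ L) = b' := by
      intro a b b' h h'
      rw [QuotientAddGroup.eq]
      have := K.add_mem (K.neg_mem h) h'
      simpa [L] using this
    let f : C →+ B ⧸ L := AddMonoidHom.mk' (fun c => (s c : B ⧸ L)) (by
      intro c d
      exact key _ _ _ (hs (c + d)) (K.add_mem (hs c) (hs d)))
    refine ⟨⟨C, L, f⟩, ?_⟩
    ext ⟨a, b⟩
    constructor
    · rintro ⟨h, hb⟩
      have h1 : (s ⟨a, h⟩ : B ⧸ L) = b := hb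
      rw [QuotientAddGroup.eq] at h1
      have := K.add_mem (hs ⟨a, h⟩) h1
      simpa using this
    · intro h
      have ha : a ∈ C := ⟨(a, b), h, rfl⟩
      exact ⟨ha, key _ _ _ (hs ⟨a, ha⟩) h⟩

theorem card_graphSubgroup [Finite A] [Finite B] (C : AddSubgroup A) (L : AddSubgroup B)
    (f : C →+ B ⧸ L) : Nat.card (graphSubgroup C L f) = Nat.card C * Nat.card L := by
  have hker : graphSubgroup C L f ⊓ (AddMonoidHom.fst A B).ker =
      L.map (AddMonoidHom.inr A B) := by
    ext ⟨a, b⟩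
    have hL := SetLike.ext_iff.1 (inr_graphSubgroup C L f)
    simp only [AddSubgroup.mem_inf, AddMonoidHom.mem_ker, AddMonoidHom.coe_fst,
      AddSubgroup.mem_map, ← hL, AddSubgroup.mem_comap, AddMonoidHom.inr_apply, Prod.mk.injEq]
    constructor
    · rintro ⟨h, rfl⟩
      exact ⟨b, h, rfl, rfl⟩
    · rintro ⟨b, h, rfl, rfl⟩
      exact ⟨h, rfl⟩
  have h := AddSubgroup.card_mul_index
    ((AddMonoidHom.fst A B).comp (graphSubgroup C L f).subtype).ker
  rw [AddSubgroup.index_ker, AddMonoidHom.range_comp, AddSubgroup.range_subtype,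
    fst_graphSubgroup] at h
  rw [← h, mul_comm]
  congr 1
  rw [← AddSubgroup.card_map_of_injective (f := (graphSubgroup C L f).subtype)
    (AddSubgroup.subtype_injective _),
    ← AddSubgroup.card_map_of_injective (f := AddMonoidHom.inr A B)
    (fun x y h => (Prod.mk.inj h).2), ← hker]
  congr 2
  ext x
  simp only [AddSubgroup.mem_map, AddMonoidHom.mem_ker, AddSubgroup.mem_inf]
  constructor
  · rintro ⟨y, hy, rfl⟩
    exact ⟨y.2, hy⟩
  · rintro ⟨hx, hx0⟩
    exact ⟨⟨x, hx⟩, hx0, rfl⟩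

theorem index_graphSubgroup [Finite A] [Finite B] (C : AddSubgroup A) (L : AddSubgroup B)
    (f : C →+ B ⧸ L) : (graphSubgroup C L f).index = C.index * L.index := by
  have h := (graphSubgroup C L f).card_mul_index
  rw [card_graphSubgroup, Nat.card_prod, ← C.card_mul_index, ← L.card_mul_index] at h
  have h1 : 0 < Nat.card C * Nat.card L := Nat.mul_pos Nat.card_pos Nat.card_pos
  exact Nat.eq_of_mul_eq_mul_left h1 (by rw [h]; ring)

end Graph

/-- The sum of the `e`-th powers of the indices of all subgroups of `B`. -/
noncomputable def indexPowSum (e : ℕ) (B : Type*) [AddCommGroup B] : ℕ :=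
  ∑ᶠ L : AddSubgroup B, L.index ^ e

theorem indexPowSum_zero (B : Type*) [AddCommGroup B] [Finite B] :
    indexPowSum 0 B = Nat.card (AddSubgroup B) := by
  have := Fintype.ofFinite (AddSubgroup B)
  simp [indexPowSum, finsum_eq_sum_of_fintype]

theorem indexPowSum_congr {A B : Type*} [AddCommGroup A] [AddCommGroup B] (e : ℕ) (φ : A ≃+ B) :
    indexPowSum e A = indexPowSum e B := by
  refine finsum_eq_of_bijective _ φ.mapAddSubgroup.bijective fun L => ?_
  congr 1
  exact (AddSubgroup.index_map_equiv L φ).symm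

theorem indexPowSum_prod (e : ℕ) (A B : Type*) [AddCommGroup A] [AddCommGroup B]
    [Fintype (AddSubgroup A)] [Fintype (AddSubgroup B)] [Finite A] [Finite B] :
    indexPowSum e (A × B) = ∑ C : AddSubgroup A, ∑ L : AddSubgroup B,
      Nat.card (C →+ B ⧸ L) * (C.index * L.index) ^ e := by
  have inst (C : AddSubgroup A) (L : AddSubgroup B) : Finite (C →+ B ⧸ L) :=
    .of_injective _ DFunLike.coe_injective
  have (C : AddSubgroup A) (L : AddSubgroup B) := Fintype.ofFinite (C →+ B ⧸ L)
  rw [indexPowSum, ← finsum_eq_of_bijective _ graphSubgroup_bijective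
    (f := fun t => (t.1.index * t.2.1.index) ^ e) (fun t => by rw [index_graphSubgroup]),
    finsum_eq_sum_of_fintype, Fintype.sum_sigma]
  refine Finset.sum_congr rfl fun C _ => ?_
  rw [Fintype.sum_sigma]
  simp [Nat.card_eq_fintype_card]

section Hom

variable {A B : Type*} [AddCommGroup A] [AddCommGroup B]

/-- Homomorphisms out of a finite cyclic group correspond to elements killed by its order. -/
theorem card_addMonoidHom_of_isAddCyclic [Finite A] [IsAddCyclic A] :
    Nat.card (A →+ B) = Nat.card {b : B // Nat.card A • b = 0} := by
  obtain ⟨g, hg⟩ := IsAddCyclic.exists_generator (α := A)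
  let φ := zmodAddEquivOfGenerator hg rfl
  refine Nat.card_congr (Equiv.trans (AddEquiv.addMonoidHomCongrLeftEquiv φ.symm) ?_)
  refine (ZMod.lift (Nat.card A) (A := B)).symm.trans ?_
  refine (Equiv.subtypeEquiv (zmultiplesHom B) ?_).symm
  simp

theorem card_nsmul_eq_zero_le_of_isAddCyclic [Finite B] [IsAddCyclic B] {n : ℕ} (hn : 0 < n) :
    Nat.card {b : B // n • b = 0} ≤ n := by
  classical
  have := Fintype.ofFinite B
  rw [Nat.card_eq_fintype_card, Fintype.card_subtype]
  exact IsAddCyclic.card_nsmul_eq_zero_le hn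

theorem card_injective_of_isAddCyclic [Finite A] [IsAddCyclic A] :
    Function.Injective (fun C : AddSubgroup A => Nat.card C) := by
  have key (C : AddSubgroup A) : (C : Set A) = {a | Nat.card C • a = 0} := by
    refine Set.eq_of_subset_of_ncard_le (fun a ha => ?_) ?_ (Set.toFinite _)
    · exact congrArg Subtype.val (card_nsmul_eq_zero' (x := (⟨a, ha⟩ : C)))
    · exact card_nsmul_eq_zero_le_of_isAddCyclic Nat.card_pos
  intro C D h
  apply SetLike.coe_injective
  simp only at h
  rw [key C, key D, h]

end Hom

section Bounds

variable {p : ℕ}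

theorem indexPowSum_le_of_isAddCyclic {A : Type*} [AddCommGroup A] [Finite A] [IsAddCyclic A]
    (hp : p.Prime) {a : ℕ} (hA : Nat.card A = p ^ a) (e : ℕ) :
    indexPowSum e A ≤ ∑ i ∈ Finset.range (a + 1), (p ^ i) ^ e := by
  classical
  have := Fintype.ofFinite (AddSubgroup A)
  have hinj : Function.Injective (fun C : AddSubgroup A => C.index) := by
    intro C D h
    apply card_injective_of_isAddCyclic
    have h1 := C.card_mul_index.trans D.card_mul_index.symm
    simp only at h
    rw [h] at h1
    exact Nat.eq_of_mul_eq_mul_right (Nat.pos_of_ne_zero D.index_ne_zero_of_finite) h1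
  rw [indexPowSum, finsum_eq_sum_of_fintype,
    ← Finset.sum_image (f := fun n => n ^ e) (g := fun C : AddSubgroup A => C.index)
      hinj.injOn, ← Nat.sum_divisors_prime_pow (f := fun n => n ^ e) hp]
  refine Finset.sum_le_sum_of_subset fun n hn => ?_
  obtain ⟨C, -, rfl⟩ := Finset.mem_image.1 hn
  rw [Nat.mem_divisors, ← hA]
  exact ⟨C.index_dvd_card, Nat.card_pos.ne'⟩

theorem card_addSubgroup_le_of_isAddCyclic {A : Type*} [AddCommGroup A] [Finite A] [IsAddCyclic A]
    (hp : p.Prime) {a : ℕ} (hA : Nat.card A = p ^ a) : Nat.card (AddSubgroup A) ≤ a + 1 := by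
  simpa [indexPowSum_zero] using indexPowSum_le_of_isAddCyclic hp hA 0

theorem card_addSubgroup_prod_le {A B : Type*} [AddCommGroup A] [AddCommGroup B] [Finite A]
    [Finite B] [IsAddCyclic A] (hp : p.Prime) {a : ℕ} (hA : Nat.card A = p ^ a) :
    Nat.card (AddSubgroup (A × B)) ≤ Nat.card (AddSubgroup B) + a * indexPowSum 1 B := by
  classical
  have := Fintype.ofFinite (AddSubgroup A)
  have := Fintype.ofFinite (AddSubgroup B)
  have hcard := card_addSubgroup_le_of_isAddCyclic hp hA
  rw [← indexPowSum_zero, indexPowSum_prod, ← Finset.add_sum_erase _ _ (Finset.mem_univ ⊥)]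
  gcongr ?_ + ?_
  · simp
  · calc _ ≤ ∑ C ∈ Finset.univ.erase (⊥ : AddSubgroup A), indexPowSum 1 B := by
          refine Finset.sum_le_sum fun C _ => ?_
          rw [indexPowSum, finsum_eq_sum_of_fintype]
          refine Finset.sum_le_sum fun L _ => ?_
          rw [pow_zero, mul_one, pow_one, card_addMonoidHom_of_isAddCyclic]
          exact Nat.card_le_card_of_injective _ Subtype.val_injective
      _ ≤ a * indexPowSum 1 B := by
          rw [Finset.sum_const, smul_eq_mul, Finset.card_erase_of_mem (Finset.mem_univ _),
            Finset.card_univ, ← Nat.card_eq_fintype_card]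
          gcongr
          omega

theorem indexPowSum_one_prod_le {A B : Type*} [AddCommGroup A] [AddCommGroup B] [Finite A]
    [Finite B] [IsAddCyclic A] [IsAddCyclic B] (hp : p.Prime) {a : ℕ} (hA : Nat.card A = p ^ a) :
    indexPowSum 1 (A × B) ≤ (a + 1) * p ^ a * indexPowSum 1 B := by
  classical
  have := Fintype.ofFinite (AddSubgroup A)
  have := Fintype.ofFinite (AddSubgroup B)
  have hcard := card_addSubgroup_le_of_isAddCyclic hp hA
  rw [indexPowSum_prod]
  calc _ ≤ ∑ C : AddSubgroup A, p ^ a * indexPowSum 1 B := by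
        refine Finset.sum_le_sum fun C _ => ?_
        rw [indexPowSum, finsum_eq_sum_of_fintype, Finset.mul_sum]
        refine Finset.sum_le_sum fun L _ => ?_
        have : IsAddCyclic (B ⧸ L) :=
          isAddCyclic_of_surjective (QuotientAddGroup.mk' L) (QuotientAddGroup.mk'_surjective L)
        rw [pow_one, pow_one, card_addMonoidHom_of_isAddCyclic, ← hA, ← C.card_mul_index, mul_assoc]
        gcongr
        exact card_nsmul_eq_zero_le_of_isAddCyclic Nat.card_pos
    _ ≤ (a + 1) * p ^ a * indexPowSum 1 B := by
        rw [Finset.sum_const, smul_eq_mul, Finset.card_univ, ← Nat.card_eq_fintype_card, mul_assoc]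
        gcongr

theorem pred_mul_sum_range_pow_le {q : ℕ} (hq : q + 1 ≤ p) (c : ℕ) :
    q * ∑ i ∈ Finset.range (c + 1), p ^ i ≤ (q + 1) * p ^ c := by
  induction c with
  | zero => simp
  | succ c ih =>
    rw [Finset.sum_range_succ, mul_add]
    have : (q + 1) * p ^ c ≤ p ^ (c + 1) := by
      rw [pow_succ, mul_comm]
      gcongr
    linarith

theorem pred_mul_indexPowSum_one_zmod_le (hp : p.Prime) {q : ℕ} (hq : q + 1 ≤ p) (c : ℕ) :
    q * indexPowSum 1 (ZMod (p ^ c)) ≤ (q + 1) * p ^ c := by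
  have : NeZero (p ^ c) := ⟨pow_ne_zero _ hp.ne_zero⟩
  have h := indexPowSum_le_of_isAddCyclic (A := ZMod (p ^ c)) hp (Nat.card_zmod _) 1
  simp only [pow_one] at h
  exact (Nat.mul_le_mul_left q h).trans (pred_mul_sum_range_pow_le hq c)

theorem card_addSubgroup_zmod_le (hp : p.Prime) (a : ℕ) :
    Nat.card (AddSubgroup (ZMod (p ^ a))) ≤ p ^ a := by
  have : NeZero (p ^ a) := ⟨pow_ne_zero _ hp.ne_zero⟩
  exact (card_addSubgroup_le_of_isAddCyclic hp (Nat.card_zmod _)).trans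
    (Nat.lt_pow_self hp.one_lt)

theorem two_add_three_mul_le (a : ℕ) : 2 + 3 * a ≤ 2 * 3 ^ a := by
  induction a with
  | zero => simp
  | succ a ih => rw [pow_succ]; linarith

theorem four_add_five_mul_le (a : ℕ) : 4 + 5 * (a * (a + 1)) ≤ 4 * 5 ^ a := by
  induction a with
  | zero => simp
  | succ a ih => rw [pow_succ]; nlinarith

theorem card_addSubgroup_zmod_prod_le (hp : p.Prime) (h3 : 3 ≤ p) (a b : ℕ) :
    Nat.card (AddSubgroup (ZMod (p ^ a) × ZMod (p ^ b))) ≤ p ^ a * p ^ b := by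
  have : NeZero (p ^ a) := ⟨pow_ne_zero _ hp.ne_zero⟩
  have : NeZero (p ^ b) := ⟨pow_ne_zero _ hp.ne_zero⟩
  have h1 := card_addSubgroup_prod_le (A := ZMod (p ^ a)) (B := ZMod (p ^ b)) hp (Nat.card_zmod _)
  have h2 := card_addSubgroup_zmod_le hp b
  have h4 := Nat.mul_le_mul_left a (pred_mul_indexPowSum_one_zmod_le hp (q := 2) h3 b)
  have h5 : 2 + 3 * a ≤ 2 * p ^ a := by
    exact (two_add_three_mul_le a).trans (by gcongr)
  have h6 := Nat.mul_le_mul_right (p ^ b) h5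
  linarith

theorem card_addSubgroup_zmod_prod_prod_le_of_le (hp : p.Prime) (h5 : 5 ≤ p) {a b : ℕ} (c : ℕ)
    (hab : b ≤ a) :
    Nat.card (AddSubgroup (ZMod (p ^ a) × ZMod (p ^ b) × ZMod (p ^ c))) ≤
      p ^ a * (p ^ b * p ^ c) := by
  have : NeZero (p ^ a) := ⟨pow_ne_zero _ hp.ne_zero⟩
  have : NeZero (p ^ b) := ⟨pow_ne_zero _ hp.ne_zero⟩
  have : NeZero (p ^ c) := ⟨pow_ne_zero _ hp.ne_zero⟩
  have h1 := card_addSubgroup_prod_le (A := ZMod (p ^ a)) (B := ZMod (p ^ b) × ZMod (p ^ c)) hp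
    (Nat.card_zmod _)
  have h2 := card_addSubgroup_zmod_prod_le hp (by omega) b c
  have h3 := indexPowSum_one_prod_le (A := ZMod (p ^ b)) (B := ZMod (p ^ c)) hp (Nat.card_zmod _)
  have h4 := pred_mul_indexPowSum_one_zmod_le hp (q := 4) h5 c
  have h6 : 4 + 5 * (a * (a + 1)) ≤ 4 * p ^ a := by
    exact (four_add_five_mul_le a).trans (by gcongr)
  have h7 : 4 * indexPowSum 1 (ZMod (p ^ b) × ZMod (p ^ c)) ≤
      5 * (a + 1) * (p ^ b * p ^ c) := calc
    _ ≤ 4 * ((b + 1) * p ^ b * indexPowSum 1 (ZMod (p ^ c))) := by gcongr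
    _ = (b + 1) * p ^ b * (4 * indexPowSum 1 (ZMod (p ^ c))) := by ring
    _ ≤ (a + 1) * p ^ b * ((4 + 1) * p ^ c) := by gcongr
    _ = _ := by ring
  have h8 := Nat.mul_le_mul_left a h7
  have h9 := Nat.mul_le_mul_right (p ^ b * p ^ c) h6
  linarith

theorem card_addSubgroup_zmod_prod_prod_le (hp : p.Prime) (h5 : 5 ≤ p) (a b c : ℕ) :
    Nat.card (AddSubgroup (ZMod (p ^ a) × ZMod (p ^ b) × ZMod (p ^ c))) ≤
      p ^ a * (p ^ b * p ^ c) := by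
  rcases le_total b a with h | h
  · exact card_addSubgroup_zmod_prod_prod_le_of_le hp h5 c h
  · let φ : ZMod (p ^ a) × ZMod (p ^ b) × ZMod (p ^ c) ≃+
        ZMod (p ^ b) × ZMod (p ^ a) × ZMod (p ^ c) :=
      AddEquiv.prodAssoc.symm.trans
        ((AddEquiv.prodComm.prodCongr (AddEquiv.refl _)).trans AddEquiv.prodAssoc)
    rw [Nat.card_congr φ.mapAddSubgroup.toEquiv, mul_left_comm]
    exact card_addSubgroup_zmod_prod_prod_le_of_le hp h5 c h

theorem le_indexPowSum_zmod_prod (hp : p.Prime) (e : ℕ) {B : Type*} [AddCommGroup B] [Finite B]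
    (hB : ∀ b : B, p • b = 0) :
    p ^ e * indexPowSum e B + indexPowSum (e + 1) B ≤ indexPowSum e (ZMod p × B) := by
  classical
  have := Fact.mk hp
  have := Fintype.ofFinite (AddSubgroup (ZMod p))
  have := Fintype.ofFinite (AddSubgroup B)
  rw [indexPowSum_prod]
  refine le_trans (le_of_eq ?_) (Finset.sum_le_sum_of_subset (Finset.subset_univ {⊥, ⊤}))
  rw [Finset.sum_pair bot_ne_top, indexPowSum, indexPowSum, finsum_eq_sum_of_fintype,
    finsum_eq_sum_of_fintype, Finset.mul_sum]
  congr 1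
  · refine Finset.sum_congr rfl fun L _ => ?_
    simp [mul_pow]
  · refine Finset.sum_congr rfl fun L _ => ?_
    have hq (x : B ⧸ L) : p • x = 0 := by
      obtain ⟨b, rfl⟩ := QuotientAddGroup.mk_surjective x
      rw [← QuotientAddGroup.mk_nsmul, hB, QuotientAddGroup.mk_zero]
    rw [card_addMonoidHom_of_isAddCyclic, AddSubgroup.index_top, one_mul, pow_succ']
    simp [hq, AddSubgroup.index]

theorem le_indexPowSum_pi (hp : p.Prime) (e m : ℕ) :
    p ^ e * indexPowSum e (Fin m → ZMod p) + indexPowSum (e + 1) (Fin m → ZMod p) ≤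
      indexPowSum e (Fin (m + 1) → ZMod p) := by
  have := Fact.mk hp
  rw [← indexPowSum_congr e (Fin.consLinearEquiv ℤ fun _ : Fin (m + 1) => ZMod p).toAddEquiv]
  exact le_indexPowSum_zmod_prod hp e fun b => by ext; simp

theorem indexPowSum_pi_zero (e : ℕ) : indexPowSum e (Fin 0 → ZMod p) = 1 := by
  have := Fintype.ofFinite (AddSubgroup (Fin 0 → ZMod p))
  rw [indexPowSum, finsum_eq_sum_of_fintype, Fintype.sum_unique,
    Subsingleton.elim default ⊤, AddSubgroup.index_top, one_pow]

theorem lt_card_addSubgroup_pi (hp : p.Prime) {m : ℕ}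
    (h : m = 2 ∧ p < 3 ∨ m = 3 ∧ p = 3 ∨ m = 4) :
    p ^ m < Nat.card (AddSubgroup (Fin m → ZMod p)) := by
  have := Fact.mk hp
  have h1 (e : ℕ) : p ^ e + 1 ≤ indexPowSum e (Fin 1 → ZMod p) := by
    simpa [indexPowSum_pi_zero] using le_indexPowSum_pi hp e 0
  have h2 (e : ℕ) : p ^ e * (p ^ e + 1) + (p ^ (e + 1) + 1) ≤ indexPowSum e (Fin 2 → ZMod p) :=
    le_trans (by gcongr <;> exact h1 _) (le_indexPowSum_pi hp e 1)
  have h3 (e : ℕ) : p ^ e * (p ^ e * (p ^ e + 1) + (p ^ (e + 1) + 1)) +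
      (p ^ (e + 1) * (p ^ (e + 1) + 1) + (p ^ (e + 1 + 1) + 1)) ≤
        indexPowSum e (Fin 3 → ZMod p) :=
    le_trans (by gcongr <;> exact h2 _) (le_indexPowSum_pi hp e 2)
  rw [← indexPowSum_zero]
  rcases h with ⟨rfl, h⟩ | ⟨rfl, rfl⟩ | rfl
  · obtain rfl : p = 2 := le_antisymm (by omega) hp.two_le
    exact lt_of_lt_of_le (by norm_num) (h2 0)
  · exact lt_of_lt_of_le (by norm_num) (h3 0)
  · refine lt_of_lt_of_le ?_ ((Nat.add_le_add (Nat.mul_le_mul_left _ (h3 0)) (h3 1)).trans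
      (le_indexPowSum_pi hp 0 3))
    ring_nf
    omega

end Bounds

section PiFin

/-- A product indexed by `Fin 2` as a binary product. -/
def piFinTwoAddEquiv (M : Fin 2 → Type*) [∀ i, AddCommGroup (M i)] :
    (∀ i, M i) ≃+ M 0 × M 1 :=
  { piFinTwoEquiv M with map_add' := fun _ _ => rfl }

/-- A product indexed by `Fin 3` as an iterated binary product. -/
def piFinThreeAddEquiv (M : Fin 3 → Type*) [∀ i, AddCommGroup (M i)] :
    (∀ i, M i) ≃+ M 0 × M 1 × M 2 :=
  (Fin.consLinearEquiv ℤ M).symm.toAddEquiv.trans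
    ((AddEquiv.refl _).prodCongr (piFinTwoAddEquiv fun i => M i.succ))

end PiFin

section Torsion

variable {p : ℕ}

theorem card_torsion_zmod (hp : p.Prime) {d : ℕ} (hd : 1 ≤ d) :
    Nat.card {x : ZMod (p ^ d) // p • x = 0} = p := by
  have : NeZero (p ^ d) := ⟨pow_ne_zero _ hp.ne_zero⟩
  have h := IsCyclic.card_powMonoidHom_ker (Multiplicative (ZMod (p ^ d))) p
  rw [Nat.card_congr Multiplicative.toAdd, Nat.card_zmod,
    Nat.gcd_eq_right (dvd_pow_self p (by omega))] at h
  exact h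

theorem card_torsion_pi {ι : Type*} [Fintype ι] (hp : p.Prime) {d : ι → ℕ} (hd : ∀ i, 1 ≤ d i) :
    Nat.card {x : ∀ i, ZMod (p ^ d i) // p • x = 0} = p ^ Fintype.card ι := by
  let φ : {x : ∀ i, ZMod (p ^ d i) // p • x = 0} ≃ ∀ i, {x : ZMod (p ^ d i) // p • x = 0} :=
    (Equiv.subtypeEquivRight fun _ => funext_iff).trans
      (Equiv.subtypePiEquivPi (p := fun i (x : ZMod (p ^ d i)) => p • x = 0))
  rw [Nat.card_congr φ, Nat.card_pi]
  simp only [card_torsion_zmod hp (hd _), Finset.prod_const, Finset.card_univ]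

theorem card_torsion_prod_le {A B : Type*} [AddCommGroup A] [AddCommGroup B] [Finite A] [Finite B] :
    Nat.card {x : A × B // p • x = 0} ≤
      Nat.card {x : A // p • x = 0} * Nat.card {x : B // p • x = 0} := by
  rw [← Nat.card_prod]
  refine Nat.card_le_card_of_injective
    (fun x => (⟨x.1.1, congrArg Prod.fst x.2⟩, ⟨x.1.2, congrArg Prod.snd x.2⟩)) ?_
  rintro ⟨⟨a, b⟩, _⟩ ⟨⟨a', b'⟩, _⟩ h
  simpa using h

theorem card_torsion_le_of_injective {A B : Type*} [AddCommGroup A] [AddCommGroup B] [Finite B]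
    (f : A →+ B) (hf : Function.Injective f) :
    Nat.card {x : A // p • x = 0} ≤ Nat.card {x : B // p • x = 0} := by
  refine Nat.card_le_card_of_injective
    (fun x => ⟨f x.1, by rw [← map_nsmul, x.2, map_zero]⟩) fun x y h => ?_
  exact Subtype.ext (hf (congrArg Subtype.val h))

/-- A finite abelian `p`-group is a product of nontrivial cyclic `p`-groups. -/
theorem exists_addEquiv_pi_zmod (hp : p.Prime) {G : Type*} [AddCommGroup G] [Finite G] {n : ℕ}
    (hG : Nat.card G = p ^ n) :
    ∃ (k : ℕ) (d : Fin k → ℕ), (∀ i, 1 ≤ d i) ∧ Nonempty (G ≃+ ∀ i, ZMod (p ^ d i)) := by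
  obtain ⟨ι, _, m, hm, ⟨φ⟩⟩ := AddCommGroup.equiv_directSum_zmod_of_finite' G
  classical
  let ψ : G ≃+ ∀ i, ZMod (m i) := φ.trans (DirectSum.addEquivProd _)
  have hprod : ∏ i, m i = p ^ n := by
    rw [← hG, Nat.card_congr ψ.toEquiv, Nat.card_pi]
    simp
  have hpow (i : ι) : ∃ d, 1 ≤ d ∧ m i = p ^ d := by
    obtain ⟨d, -, hd⟩ := (Nat.dvd_prime_pow hp).1
      (hprod ▸ Finset.dvd_prod_of_mem m (Finset.mem_univ i))
    refine ⟨d, Nat.one_le_iff_ne_zero.2 ?_, hd⟩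
    rintro rfl
    exact (hm i).ne' hd
  choose d hd hmd using hpow
  obtain rfl : m = fun i => p ^ d i := funext hmd
  let σ := Fintype.equivFin ι
  exact ⟨Fintype.card ι, fun j => d (σ.symm j), fun j => hd _,
    ⟨ψ.trans (LinearEquiv.piCongrLeft' ℤ _ σ).toAddEquiv⟩⟩

theorem exists_injective_zmod (hp : p.Prime) {d : ℕ} (hd : 1 ≤ d) :
    ∃ f : ZMod p →+ ZMod (p ^ d), Function.Injective f := by
  have := Fact.mk hp
  have : NeZero (p ^ d) := ⟨pow_ne_zero _ hp.ne_zero⟩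
  have hcard := card_torsion_zmod hp hd
  have : Nontrivial {x : ZMod (p ^ d) // p • x = 0} := by
    rw [← Finite.one_lt_card_iff_nontrivial, hcard]
    exact hp.one_lt
  obtain ⟨⟨x, hx⟩, hx0⟩ := exists_ne (⟨0, smul_zero p⟩ : {x : ZMod (p ^ d) // p • x = 0})
  let f : ZMod p →+ ZMod (p ^ d) := ZMod.lift p ⟨zmultiplesHom _ x, by simpa using hx⟩
  refine ⟨f, (AddMonoidHom.ker_eq_bot_iff f).1 ((IsSimpleAddGroup.eq_bot_or_eq_top_of_normal
    f.ker inferInstance).resolve_right fun h => hx0 (Subtype.ext ?_))⟩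
  have h1 : f ((1 : ℤ) : ZMod p) = 0 := by
    rw [← AddMonoidHom.mem_ker, h]
    trivial
  simpa [f, -Int.cast_one] using h1

theorem exists_injective_pi (hp : p.Prime) {k m : ℕ} (hmk : m ≤ k) {d : Fin k → ℕ}
    (hd : ∀ i, 1 ≤ d i) :
    ∃ f : (Fin m → ZMod p) →+ ∀ i, ZMod (p ^ d i), Function.Injective f := by
  choose f hf using fun i => exists_injective_zmod hp (hd i)
  refine ⟨AddMonoidHom.pi fun i => if h : i.1 < m then
    (f i).comp (Pi.evalAddMonoidHom _ ⟨i.1, h⟩) else 0, fun x y hxy => funext fun j => ?_⟩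
  have := congrFun hxy (Fin.castLE hmk j)
  simp only [AddMonoidHom.pi_apply, Fin.val_castLE, j.2, dite_true] at this
  exact hf _ this

end Torsion

section Main

variable {p : ℕ}

theorem card_addSubgroup_pi_le (hp : p.Prime) {k : ℕ} (d : Fin k → ℕ)
    (h : k ≤ 1 ∨ k ≤ 2 ∧ 3 ≤ p ∨ k ≤ 3 ∧ 5 ≤ p) :
    Nat.card (AddSubgroup (∀ i, ZMod (p ^ d i))) ≤ Nat.card (∀ i, ZMod (p ^ d i)) := by
  have hk : k ≤ 3 := by omega
  interval_cases k
  · simp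
  · let φ : (∀ i, ZMod (p ^ d i)) ≃+ ZMod (p ^ d 0) := AddEquiv.piUnique fun i => ZMod (p ^ d i)
    rw [Nat.card_congr φ.mapAddSubgroup.toEquiv, Nat.card_congr φ.toEquiv, Nat.card_zmod]
    exact card_addSubgroup_zmod_le hp _
  · let φ := piFinTwoAddEquiv fun i => ZMod (p ^ d i)
    rw [Nat.card_congr φ.mapAddSubgroup.toEquiv, Nat.card_congr φ.toEquiv, Nat.card_prod,
      Nat.card_zmod, Nat.card_zmod]
    exact card_addSubgroup_zmod_prod_le hp (by omega) _ _
  · let φ := piFinThreeAddEquiv fun i => ZMod (p ^ d i)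
    rw [Nat.card_congr φ.mapAddSubgroup.toEquiv, Nat.card_congr φ.toEquiv, Nat.card_prod,
      Nat.card_prod, Nat.card_zmod, Nat.card_zmod, Nat.card_zmod]
    exact card_addSubgroup_zmod_prod_prod_le hp (by omega) _ _ _

theorem card_addSubgroup_le_of_card_torsion_le (hp : p.Prime) {H : Type*} [AddCommGroup H]
    [Finite H] {n r : ℕ} (hH : Nat.card H = p ^ n)
    (ht : Nat.card {x : H // p • x = 0} ≤ p ^ r)
    (h : r ≤ 1 ∨ r ≤ 2 ∧ 3 ≤ p ∨ r ≤ 3 ∧ 5 ≤ p) :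
    Nat.card (AddSubgroup H) ≤ Nat.card H := by
  obtain ⟨k, d, hd, ⟨φ⟩⟩ := exists_addEquiv_pi_zmod hp hH
  have hk : p ^ k ≤ p ^ r := by
    have := card_torsion_le_of_injective (p := p) φ.symm.toAddMonoidHom φ.symm.injective
    rw [card_torsion_pi hp hd, Fintype.card_fin] at this
    exact this.trans ht
  rw [Nat.pow_le_pow_iff_right hp.one_lt] at hk
  rw [Nat.card_congr φ.mapAddSubgroup.toEquiv, Nat.card_congr φ.toEquiv]
  exact card_addSubgroup_pi_le hp d (by omega)

theorem beta_le_one_iff (G : Type*) [Group G] [Finite G] :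
    beta G ≤ 1 ↔ Nat.card (AddSubgroup (Additive G)) ≤ Nat.card G := by
  rw [beta, div_le_one (by exact_mod_cast Nat.card_pos), Nat.cast_le,
    Nat.card_congr Subgroup.toAddSubgroup.toEquiv]

theorem not_forall_beta_le_one (hp : p.Prime) {G : Type*} [CommGroup G] [Finite G] {k m : ℕ}
    (hmk : m ≤ k) {d : Fin k → ℕ} (hd : ∀ i, 1 ≤ d i)
    (φ : Additive G ≃+ ∀ i, ZMod (p ^ d i)) (h : m = 2 ∧ p < 3 ∨ m = 3 ∧ p = 3 ∨ m = 4) :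
    ¬ ∀ H : Subgroup G, beta H ≤ 1 := by
  have := Fact.mk hp
  obtain ⟨f, hf⟩ := exists_injective_pi hp hmk hd
  let g : (Fin m → ZMod p) →+ Additive G := φ.symm.toAddMonoidHom.comp f
  have hg : Function.Injective g := φ.symm.injective.comp hf
  let H : Subgroup G := (AddMonoidHom.toMultiplicativeLeft g).range
  let ψ : (Fin m → ZMod p) ≃+ Additive H :=
    MulEquiv.toAdditiveRight (MonoidHom.ofInjective (f := AddMonoidHom.toMultiplicativeLeft g) hg)
  intro hall
  have h1 := (beta_le_one_iff H).1 (hall H)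
  have h2 := lt_card_addSubgroup_pi hp h
  rw [Nat.card_congr ψ.mapAddSubgroup.toEquiv] at h2
  have h3 : p ^ m = Nat.card H := by
    rw [← Nat.card_congr (ψ.toEquiv.trans Additive.toMul)]
    simp
  omega

end Main

theorem stmt_18 (p : ℕ) (hp : p.Prime) (G : Type) [CommGroup G] [Finite G]
    (hpG : IsPGroup p G) :
    (∀ H : Subgroup G, beta ↥H ≤ 1) ↔
      (IsCyclic G ∨
       ((∃ d1 d2 : ℕ, 1 ≤ d1 ∧ 1 ≤ d2 ∧
          Nonempty (G ≃* Multiplicative (ZMod (p ^ d1)) × Multiplicative (ZMod (p ^ d2))))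
         ∧ 3 ≤ p) ∨
       ((∃ d1 d2 d3 : ℕ, 1 ≤ d1 ∧ 1 ≤ d2 ∧ 1 ≤ d3 ∧
          Nonempty (G ≃* Multiplicative (ZMod (p ^ d1)) × Multiplicative (ZMod (p ^ d2)) ×
            Multiplicative (ZMod (p ^ d3)))) ∧ 5 ≤ p)) := by
  have := Fact.mk hp
  have hne (d : ℕ) : NeZero (p ^ d) := ⟨pow_ne_zero _ hp.ne_zero⟩
  obtain ⟨n, hn⟩ := IsPGroup.iff_card.1 hpG
  constructor
  · intro hall
    obtain ⟨k, d, hd, ⟨φ⟩⟩ := exists_addEquiv_pi_zmod (G := Additive G) hp hn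
    have hbad {m : ℕ} (hmk : m ≤ k) (h : m = 2 ∧ p < 3 ∨ m = 3 ∧ p = 3 ∨ m = 4) : False :=
      not_forall_beta_le_one hp hmk hd φ h hall
    have hk : k < 4 := by
      by_contra! hk
      exact hbad hk (by simp)
    have h3 (h2k : 2 ≤ k) : 3 ≤ p := by
      by_contra! h
      exact hbad h2k (by omega)
    interval_cases k
    · left
      rw [← isAddCyclic_additive_iff]
      exact isAddCyclic_of_injective φ.toAddMonoidHom φ.injective
    · left
      rw [← isAddCyclic_additive_iff]
      let ψ : (∀ i, ZMod (p ^ d i)) ≃+ ZMod (p ^ d 0) := AddEquiv.piUnique fun i => ZMod (p ^ d i)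
      exact isAddCyclic_of_injective (φ.trans ψ).toAddMonoidHom (φ.trans ψ).injective
    · right; left
      refine ⟨⟨d 0, d 1, hd 0, hd 1, ⟨?_⟩⟩, h3 le_rfl⟩
      exact (AddEquiv.toMultiplicativeRight
        (φ.trans (piFinTwoAddEquiv fun i => ZMod (p ^ d i)))).trans (MulEquiv.prodMultiplicative _ _)
    · right; right
      refine ⟨⟨d 0, d 1, d 2, hd 0, hd 1, hd 2, ⟨?_⟩⟩, ?_⟩
      · exact ((AddEquiv.toMultiplicativeRight
          (φ.trans (piFinThreeAddEquiv fun i => ZMod (p ^ d i)))).trans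
            (MulEquiv.prodMultiplicative _ _)).trans
              ((MulEquiv.refl _).prodCongr (MulEquiv.prodMultiplicative _ _))
      · have := h3 (by norm_num)
        by_contra! h
        interval_cases p
        · exact hbad le_rfl (by simp)
        · exact absurd hp (by norm_num)
  · intro h H
    rw [beta_le_one_iff]
    obtain ⟨m, hm⟩ := IsPGroup.iff_card.1 (hpG.to_subgroup H)
    have hH := card_torsion_le_of_injective (p := p) (MonoidHom.toAdditive H.subtype)
      H.subtype_injective
    rcases h with h | ⟨⟨d1, d2, hd1, hd2, ⟨φ⟩⟩, h3⟩ | ⟨⟨d1, d2, d3, hd1, hd2, hd3, ⟨φ⟩⟩, h5⟩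
    · have : IsAddCyclic (Additive G) := isAddCyclic_additive_iff.2 h
      have ht := card_nsmul_eq_zero_le_of_isAddCyclic (B := Additive G) hp.pos
      exact card_addSubgroup_le_of_card_torsion_le (r := 1) (H := Additive H) hp hm
        (hH.trans (by rwa [pow_one])) (by simp)
    · let ψ : Additive G ≃+ ZMod (p ^ d1) × ZMod (p ^ d2) :=
        MulEquiv.toAdditiveLeft (φ.trans (MulEquiv.prodMultiplicative _ _).symm)
      have ht := (card_torsion_le_of_injective (p := p) ψ.toAddMonoidHom ψ.injective).trans
        card_torsion_prod_le
      rw [card_torsion_zmod hp hd1, card_torsion_zmod hp hd2, ← pow_two] at ht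
      exact card_addSubgroup_le_of_card_torsion_le (H := Additive H) hp hm (hH.trans ht)
        (by omega)
    · let ψ : Additive G ≃+ ZMod (p ^ d1) × ZMod (p ^ d2) × ZMod (p ^ d3) :=
        MulEquiv.toAdditiveLeft ((φ.trans ((MulEquiv.refl _).prodCongr
          (MulEquiv.prodMultiplicative _ _).symm)).trans (MulEquiv.prodMultiplicative _ _).symm)
      have ht := (card_torsion_le_of_injective (p := p) ψ.toAddMonoidHom ψ.injective).trans
        (card_torsion_prod_le.trans (Nat.mul_le_mul_left _ card_torsion_prod_le))
      rw [card_torsion_zmod hp hd1, card_torsion_zmod hp hd2, card_torsion_zmod hp hd3,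
        ← pow_two, ← pow_succ'] at ht
      exact card_addSubgroup_le_of_card_torsion_le (H := Additive H) hp hm (hH.trans ht)
        (by omega)
end
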